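/- arXiv:2005.10773 — 2 statements merged into one kernel-verified Lean document; each statement's English description precedes it below -/
import Mathlib

section
/- The metric space (𝒟, d) of persistence diagrams with the bottleneck metric has infinite asymptotic dimension in the sense of Gromov: for every n ∈ ℕ there exists D > 0 such that there is no cover 𝒰 of 𝒟 which is uniformly bounded (i.e., sup{diam(A) : A ∈ 𝒰} < ∞) and which can be written as 𝒰 = 𝒰_0 ∪ ⋯ ∪ 𝒰_n where each family 𝒰_i is D-disjoint (i.e., for every two distinct A, B ∈ 𝒰_i, dist(A,B) ≥ D). -/
noncomputable section

/-- The sup-norm distance on `ℝ²`. -/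
def supDist (a b : ℝ × ℝ) : ℝ := max |a.1 - b.1| |a.2 - b.2|

/-- `X = {(x,y) : 0 ≤ x < y}`, the open upper half-triangle (off-diagonal points). -/
def offDiag : Set (ℝ × ℝ) := {p | 0 ≤ p.1 ∧ p.1 < p.2}

/-- `Δ = {(x,y) : 0 ≤ x = y}`, the diagonal. -/
def diagSet : Set (ℝ × ℝ) := {p | 0 ≤ p.1 ∧ p.1 = p.2}

/-- A persistence diagram: an `ℕ`-valued function on `ℝ²` with finite support
contained in `X`. -/
structure PersDiag where
  toFun : ℝ × ℝ → ℕ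
  finite_support : (Function.support toFun).Finite
  support_subset : Function.support toFun ⊆ offDiag

/-- A sequential representation of a persistence diagram `μ`: a finite sequence of
points of `X ∪ Δ` such that every point of `X` occurs exactly `μ a` times
(the remaining terms then automatically lie in `Δ`). -/
def IsSeqRep (μ : PersDiag) {k : ℕ} (a : Fin k → ℝ × ℝ) : Prop :=
  (∀ i, a i ∈ offDiag ∪ diagSet) ∧
  (∀ p ∈ offDiag, {i : Fin k | a i = p}.ncard = μ.toFun p)

/-- The bottleneck distance between two persistence diagrams: the infimum, over all
pairs of equal-length sequential representations and all permutations (matchings),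
of the maximum of the sup-norm distances of matched points. -/
def bottleneck (μ ν : PersDiag) : ℝ :=
  sInf {r : ℝ | ∃ (k : ℕ) (a b : Fin k → ℝ × ℝ) (σ : Equiv.Perm (Fin k)),
    IsSeqRep μ a ∧ IsSeqRep ν b ∧ r = ⨆ i, supDist (a i) (b (σ i))}

/-- The topology of the bottleneck metric on the set of persistence diagrams:
the topology generated by the open balls of the bottleneck distance. -/
instance : TopologicalSpace PersDiag :=
  TopologicalSpace.generateFrom
    {U | ∃ (μ : PersDiag) (ε : ℝ), 0 < ε ∧ U = {ν | bottleneck μ ν < ε}}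

/-- The closed triangle `X̂ₙ = {(x,y) : 0 ≤ x ≤ y ≤ n}`. -/
def triangle (n : ℕ) : Set (ℝ × ℝ) := {p | 0 ≤ p.1 ∧ p.1 ≤ p.2 ∧ p.2 ≤ n}

/-- `𝒟ₙ`: persistence diagrams with at most `n` points of support, all lying in `X̂ₙ`. -/
def DD (n : ℕ) : Set PersDiag :=
  {μ | (Function.support μ.toFun).ncard ≤ n ∧ Function.support μ.toFun ⊆ triangle n}

/-- The multiset of values of a finite family of off-diagonal points, as a persistence diagram. -/
def PersDiag.ofFamily {k : ℕ} (p : Fin k → ℝ × ℝ) (hp : ∀ i, p i ∈ offDiag) : PersDiag where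
  toFun q := {i | p i = q}.ncard
  finite_support := by
    refine (Set.finite_range p).subset fun q hq ↦ ?_
    obtain ⟨i, hi⟩ := Set.nonempty_of_ncard_ne_zero hq
    exact ⟨i, hi⟩
  support_subset := by
    intro q hq
    obtain ⟨i, rfl⟩ := Set.nonempty_of_ncard_ne_zero hq
    exact hp i

lemma isSeqRep_ofFamily {k : ℕ} (p : Fin k → ℝ × ℝ) (hp : ∀ i, p i ∈ offDiag) :
    IsSeqRep (PersDiag.ofFamily p hp) p :=
  ⟨fun i ↦ Or.inl (hp i), fun _ _ ↦ rfl⟩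

lemma supDist_nonneg (a b : ℝ × ℝ) : 0 ≤ supDist a b :=
  (abs_nonneg _).trans (le_max_left _ _)

lemma bottleneck_ofFamily_le {k : ℕ} {p q : Fin k → ℝ × ℝ} (hp : ∀ i, p i ∈ offDiag)
    (hq : ∀ i, q i ∈ offDiag) {r : ℝ} (hr : 0 ≤ r) (h : ∀ i, supDist (p i) (q i) ≤ r) :
    bottleneck (.ofFamily p hp) (.ofFamily q hq) ≤ r := by
  refine le_trans (csInf_le ?_ ?_) (Real.iSup_le h hr)
  swap
  · exact ⟨k, p, q, Equiv.refl _, isSeqRep_ofFamily p hp, isSeqRep_ofFamily q hq, rfl⟩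
  refine ⟨0, ?_⟩
  rintro _ ⟨k, a, b, σ, -, -, rfl⟩
  exact Real.iSup_nonneg fun i ↦ supDist_nonneg _ _

/-- A point of the first diagram that is `r`-far from the diagonal and from the second diagram
forces the bottleneck distance to be at least `r`. -/
lemma le_bottleneck_ofFamily {k : ℕ} {p q : Fin k → ℝ × ℝ} (hp : ∀ i, p i ∈ offDiag)
    (hq : ∀ i, q i ∈ offDiag) {r : ℝ} (j : Fin k) (hdiag : ∀ z ∈ diagSet, r ≤ supDist (p j) z)
    (h : ∀ i, r ≤ supDist (p j) (q i)) :
    r ≤ bottleneck (.ofFamily p hp) (.ofFamily q hq) := by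
  refine le_csInf ⟨_, k, p, q, Equiv.refl _, isSeqRep_ofFamily p hp,
    isSeqRep_ofFamily q hq, rfl⟩ ?_
  rintro _ ⟨m, a, b, σ, ha, hb, rfl⟩
  have hne : {i | a i = p j}.ncard ≠ 0 := by
    rw [ha.2 _ (hp j)]
    exact Set.ncard_ne_zero_of_mem (a := j) rfl
  obtain ⟨i, hi⟩ := Set.nonempty_of_ncard_ne_zero hne
  refine le_trans ?_ (le_ciSup (f := fun i ↦ supDist (a i) (b (σ i)))
    (Set.finite_range _).bddAbove i)
  change r ≤ supDist (a i) (b (σ i))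
  rw [show a i = p j from hi]
  rcases hb.1 (σ i) with hX | hΔ
  · have hne' : {l | q l = b (σ i)}.ncard ≠ 0 := by
      change (PersDiag.ofFamily q hq).toFun _ ≠ 0
      rw [← hb.2 _ hX]
      exact Set.ncard_ne_zero_of_mem (a := σ i) rfl
    obtain ⟨l, hl⟩ := Set.nonempty_of_ncard_ne_zero hne'
    rw [← show q l = b (σ i) from hl]
    exact h l
  · exact hdiag _ hΔ

/-- The points of the diagram encoding a word `w` over `{0, …, M}`: the letters perturb points
that are far from each other and from the diagonal. -/
def wordPoint {M N : ℕ} (w : Fin N → Fin (M + 1)) (i : Fin N) : ℝ × ℝ :=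
  ((2 * M + 1) * i, (2 * M + 1) * i + (2 * M + 1) + (w i : ℕ))

lemma wordPoint_mem_offDiag {M N : ℕ} (w : Fin N → Fin (M + 1)) (i : Fin N) :
    wordPoint w i ∈ offDiag := by
  refine ⟨by simp only [wordPoint]; positivity, ?_⟩
  have : (0 : ℝ) < (2 * M + 1) + (w i : ℕ) := by positivity
  simp only [wordPoint]
  linarith

/-- The persistence diagram encoding a word over `{0, …, M}`. -/
def wordDiag {M N : ℕ} (w : Fin N → Fin (M + 1)) : PersDiag :=
  .ofFamily (wordPoint w) (wordPoint_mem_offDiag w)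

lemma supDist_wordPoint {M N : ℕ} (w w' : Fin N → Fin (M + 1)) (i : Fin N) :
    supDist (wordPoint w i) (wordPoint w' i) = |((w i : ℕ) : ℝ) - (w' i : ℕ)| := by
  simp [supDist, wordPoint]

lemma bottleneck_wordDiag_le {M N : ℕ} {w w' : Fin N → Fin (M + 1)} {r : ℝ} (hr : 0 ≤ r)
    (h : ∀ i, |((w i : ℕ) : ℝ) - (w' i : ℕ)| ≤ r) :
    bottleneck (wordDiag w) (wordDiag w') ≤ r :=
  bottleneck_ofFamily_le _ _ hr fun i ↦ (supDist_wordPoint w w' i).trans_le (h i)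

lemma abs_sub_le_bottleneck_wordDiag {M N : ℕ} (w w' : Fin N → Fin (M + 1)) (j : Fin N) :
    |((w j : ℕ) : ℝ) - (w' j : ℕ)| ≤ bottleneck (wordDiag w) (wordDiag w') := by
  have hle (v : Fin N → Fin (M + 1)) : ((v j : ℕ) : ℝ) ≤ M :=
    mod_cast Nat.lt_succ_iff.mp (v j).isLt
  have hM : |((w j : ℕ) : ℝ) - (w' j : ℕ)| ≤ M :=
    abs_sub_le_of_nonneg_of_le (Nat.cast_nonneg _) (hle w) (Nat.cast_nonneg _) (hle w')
  refine le_bottleneck_ofFamily _ _ j ?_ fun i ↦ ?_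
  · rintro ⟨s, t⟩ ⟨-, hst⟩
    obtain rfl : s = t := hst
    refine hM.trans (not_lt.mp fun hlt ↦ ?_)
    obtain ⟨h₁, h₂⟩ := max_lt_iff.mp (show max _ _ < _ from hlt)
    simp only [wordPoint] at h₁ h₂
    have hw : (0 : ℝ) ≤ (w j : ℕ) := Nat.cast_nonneg _
    linarith [(abs_lt.mp h₁).1, (abs_lt.mp h₂).2]
  · obtain rfl | hij := eq_or_ne j i
    · exact (supDist_wordPoint w w' j).ge
    · refine hM.trans (le_trans ?_ (le_max_left _ _))
      have hone : (1 : ℝ) ≤ |(j : ℝ) - i| := by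
        have : (1 : ℤ) ≤ |(j : ℤ) - i| := Int.one_le_abs (by
          have := Fin.val_ne_of_ne hij
          omega)
        exact_mod_cast this
      have hpos : (0 : ℝ) ≤ 2 * M + 1 := by positivity
      simp only [wordPoint, ← mul_sub, abs_mul, abs_of_nonneg hpos]
      nlinarith

/-- the space of persistence diagrams with the bottleneck metric has
infinite asymptotic dimension: for every `n` there is `D > 0` such that no uniformly
bounded cover of `𝒟` splits into `n + 1` `D`-disjoint families `𝒰₀, …, 𝒰ₙ`. -/
theorem asdim_infinite :
    ∀ n : ℕ, ∃ D : ℝ, 0 < D ∧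
      ¬ ∃ 𝒰 : Set (Set PersDiag),
          (⋃₀ 𝒰 = Set.univ) ∧
          (∃ C : ℝ, ∀ A ∈ 𝒰, ∀ μ ∈ A, ∀ ν ∈ A, bottleneck μ ν ≤ C) ∧
          (∃ V : Fin (n + 1) → Set (Set PersDiag),
            𝒰 = ⋃ i, V i ∧
            ∀ i : Fin (n + 1), ∀ A ∈ V i, ∀ B ∈ V i, A ≠ B →
              ∀ μ ∈ A, ∀ ν ∈ B, D ≤ bottleneck μ ν) := by
  intro n
  refine ⟨2, two_pos, ?_⟩
  rintro ⟨𝒰, hcov, ⟨C, hC⟩, V, rfl, hV⟩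
  have hmem (μ : PersDiag) : ∃ i, ∃ A ∈ V i, μ ∈ A := by
    obtain ⟨A, hA, hμ⟩ : μ ∈ ⋃₀ ⋃ i, V i := hcov ▸ Set.mem_univ μ
    obtain ⟨i, hi⟩ := Set.mem_iUnion.mp hA
    exact ⟨i, A, hi, hμ⟩
  choose color A hAV hA using hmem
  obtain ⟨M, hM⟩ := exists_nat_gt C
  obtain ⟨ι, _, hι⟩ := Combinatorics.Line.exists_mono_in_high_dimension (Fin (M + 1)) (Fin (n + 1))
  let e := Fintype.equivFin ι
  obtain ⟨l, c, hc⟩ := hι fun w ↦ color (wordDiag (w ∘ e.symm))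
  let μ (x : Fin (M + 1)) : PersDiag := wordDiag (l x ∘ e.symm)
  have hAc (x) : A (μ x) ∈ V c := hc x ▸ hAV (μ x)
  have hstep (x y : Fin (M + 1)) : bottleneck (μ x) (μ y) ≤ |((x : ℕ) : ℝ) - (y : ℕ)| := by
    refine bottleneck_wordDiag_le (abs_nonneg _) fun i ↦ ?_
    cases h : l.idxFun (e.symm i) <;> simp [Combinatorics.Line.apply_def, h]
  have hconst (x : Fin (M + 1)) : A (μ x) = A (μ 0) := by
    induction x using Fin.induction with
    | zero => rfl
    | succ x ih =>
      rw [← ih]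
      by_contra hne
      have h₁ := hV c _ (hAc _) _ (hAc _) hne _ (hA _) _ (hA _)
      have h₂ := hstep x.succ x.castSucc
      norm_num at h₂
      linarith
  obtain ⟨j, hj⟩ := l.proper
  have hlow := abs_sub_le_bottleneck_wordDiag (l (Fin.last M) ∘ e.symm) (l 0 ∘ e.symm) (e j)
  simp only [Function.comp_apply, Equiv.symm_apply_apply, l.apply_none _ _ hj, Fin.val_last,
    Fin.val_zero, Nat.cast_zero, sub_zero, Nat.abs_cast] at hlow
  have hup := hC (A (μ 0)) (Set.mem_iUnion.mpr ⟨c, hAc 0⟩) (μ (Fin.last M))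
    (hconst (Fin.last M) ▸ hA _) (μ 0) (hA _)
  exact absurd (hlow.trans hup) (not_le.mpr hM)
end
end

section
/- Let m ∈ ℕ, let A be a compact subset of ℝ^m, let B be a closed subset of A, and let f : B → 𝒟_∞ be a topological embedding (a homeomorphism onto its image). Then there exists a topological embedding f̄ : A → 𝒟_∞ with f̄|_B = f. -/
noncomputable section

/-- `𝒟∞`: the set of all persistence diagrams, to be endowed with the strong
(direct limit) topology with respect to the subspaces `𝒟ₙ`. -/
def DInf : Type := PersDiag

/-- The canonical map `𝒟ₙ → 𝒟∞`. -/
def DDtoDInf (n : ℕ) (μ : DD n) : DInf := μ.1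

/-- The strong (direct limit / final) topology on `𝒟∞`: a set is open iff its trace on
each `𝒟ₙ` (with its bottleneck-metric topology) is open. -/
instance : TopologicalSpace DInf :=
  ⨆ n : ℕ, TopologicalSpace.coinduced (DDtoDInf n) inferInstance

open Topology

/-! ### Matchings as multisets of pairs -/

/-- The closed region `X ∪ Δ`. -/
def upperRegion : Set (ℝ × ℝ) := {p | 0 ≤ p.1 ∧ p.1 ≤ p.2}

lemma offDiag_union_diagSet : offDiag ∪ diagSet = upperRegion := by
  ext p
  simp only [offDiag, diagSet, upperRegion, Set.mem_union, Set.mem_ofPred_eq,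
    le_iff_lt_or_eq (a := p.1)]
  tauto

lemma offDiag_subset_upperRegion : offDiag ⊆ upperRegion := fun _ h => ⟨h.1, h.2.le⟩

lemma diagSet_subset_upperRegion : diagSet ⊆ upperRegion := fun _ h => ⟨h.1, h.2.le⟩

lemma mem_diagSet_of_notMem_offDiag {p : ℝ × ℝ} (hp : p ∈ upperRegion) (h : p ∉ offDiag) :
    p ∈ diagSet :=
  ⟨hp.1, le_antisymm hp.2 (not_lt.1 fun h' => h ⟨hp.1, h'⟩)⟩

lemma notMem_offDiag_of_mem_diagSet {p : ℝ × ℝ} (hp : p ∈ diagSet) : p ∉ offDiag :=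
  fun h => h.2.ne hp.2

lemma supDist_eq_dist (a b : ℝ × ℝ) : supDist a b = dist a b := rfl

namespace PersDiag

@[ext] lemma ext {μ ν : PersDiag} (h : ∀ p ∈ offDiag, μ.toFun p = ν.toFun p) : μ = ν := by
  have : μ.toFun = ν.toFun := by
    funext p
    by_cases hp : p ∈ offDiag
    · exact h p hp
    · rw [Function.notMem_support.1 fun h' => hp (μ.support_subset h'),
        Function.notMem_support.1 fun h' => hp (ν.support_subset h')]
  cases μ; cases ν; simpa using this

/-- A multiset of points of `X ∪ Δ` represents `μ` if its off-diagonal part is `μ`. -/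
def IsRep (μ : PersDiag) (s : Multiset (ℝ × ℝ)) : Prop :=
  (∀ p ∈ s, p ∈ upperRegion) ∧ ∀ p ∈ offDiag, s.count p = μ.toFun p

/-- The diagram represented by a multiset of points. -/
def ofMultiset (s : Multiset (ℝ × ℝ)) : PersDiag where
  toFun p := open Classical in if p ∈ offDiag then s.count p else 0
  finite_support := by
    refine s.toFinset.finite_toSet.subset fun p hp => ?_
    by_contra h
    simp_all
  support_subset p hp := by
    by_contra h
    simp_all

lemma isRep_ofMultiset {s : Multiset (ℝ × ℝ)} (hs : ∀ p ∈ s, p ∈ upperRegion) :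
    (ofMultiset s).IsRep s :=
  ⟨hs, fun p hp => by simp [ofMultiset, hp]⟩

/-- The multiset of points of a diagram. -/
def toMultiset (μ : PersDiag) : Multiset (ℝ × ℝ) :=
  Finsupp.toMultiset (Finsupp.ofSupportFinite μ.toFun μ.finite_support)

lemma count_toMultiset (μ : PersDiag) (p : ℝ × ℝ) : μ.toMultiset.count p = μ.toFun p := by
  rw [toMultiset, Finsupp.count_toMultiset]; rfl

lemma mem_toMultiset {μ : PersDiag} {p : ℝ × ℝ} :
    p ∈ μ.toMultiset ↔ p ∈ Function.support μ.toFun := by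
  rw [← Multiset.count_ne_zero, count_toMultiset, Function.mem_support]

lemma isRep_toMultiset (μ : PersDiag) : μ.IsRep μ.toMultiset :=
  ⟨fun _ hp => offDiag_subset_upperRegion (μ.support_subset (mem_toMultiset.1 hp)),
    fun p _ => μ.count_toMultiset p⟩

open Classical in
lemma IsRep.filter_eq {μ : PersDiag} {s : Multiset (ℝ × ℝ)} (h : μ.IsRep s) :
    s.filter (· ∈ offDiag) = μ.toMultiset := by
  ext p
  rw [count_toMultiset, Multiset.count_filter]
  split_ifs with hp
  · exact h.2 p hp
  · exact (Function.notMem_support.1 fun h' => hp (μ.support_subset h')).symm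

lemma IsRep.mem_support {μ : PersDiag} {s : Multiset (ℝ × ℝ)} (h : μ.IsRep s) {p : ℝ × ℝ}
    (hp : p ∈ s) (hp' : p ∈ offDiag) : p ∈ Function.support μ.toFun := by
  rw [Function.mem_support, ← h.2 p hp']
  exact (Multiset.count_pos.2 hp).ne'

lemma IsRep.unique {μ ν : PersDiag} {s : Multiset (ℝ × ℝ)} (h : μ.IsRep s) (h' : ν.IsRep s) :
    μ = ν :=
  ext fun p hp => (h.2 p hp).symm.trans (h'.2 p hp)

lemma IsRep.add_diag {μ : PersDiag} {s t : Multiset (ℝ × ℝ)} (h : μ.IsRep s)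
    (ht : ∀ p ∈ t, p ∈ diagSet) : μ.IsRep (s + t) := by
  refine ⟨fun p hp => ?_, fun p hp => ?_⟩
  · rcases Multiset.mem_add.1 hp with hp | hp
    · exact h.1 p hp
    · exact diagSet_subset_upperRegion (ht p hp)
  · rw [Multiset.count_add, h.2 p hp, Multiset.count_eq_zero.2, add_zero]
    exact fun h' => notMem_offDiag_of_mem_diagSet (ht p h') hp

/-- `M` matches `μ` with `ν`, moving every point by less than `r`. -/
structure IsMatching (μ ν : PersDiag) (r : ℝ) (M : Multiset ((ℝ × ℝ) × (ℝ × ℝ))) : Prop where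
  fst : μ.IsRep (M.map Prod.fst)
  snd : ν.IsRep (M.map Prod.snd)
  dist_lt : ∀ z ∈ M, dist z.1 z.2 < r

/-- The closest point of the diagonal. -/
def diagProj (p : ℝ × ℝ) : ℝ × ℝ := ((p.1 + p.2) / 2, (p.1 + p.2) / 2)

lemma diagProj_mem {p : ℝ × ℝ} (hp : p ∈ upperRegion) : diagProj p ∈ diagSet :=
  ⟨by have := hp.1; have := hp.2; simp only [diagProj]; linarith, rfl⟩

lemma isSeqRep_iff_isRep {μ : PersDiag} {k : ℕ} {a : Fin k → ℝ × ℝ} :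
    IsSeqRep μ a ↔ μ.IsRep (Finset.univ.val.map a) := by
  rw [IsSeqRep, IsRep, offDiag_union_diagSet]
  refine and_congr (by simp) (forall₂_congr fun p _ => ?_)
  rw [Multiset.count_map, Set.ncard_eq_toFinset_card', Finset.card_def]
  simp [eq_comm, Finset.filter]

lemma exists_seqRep {μ ν : PersDiag} {M : Multiset ((ℝ × ℝ) × (ℝ × ℝ))}
    (h₁ : μ.IsRep (M.map Prod.fst)) (h₂ : ν.IsRep (M.map Prod.snd)) :
    ∃ (k : ℕ) (c : Fin k → (ℝ × ℝ) × (ℝ × ℝ)), IsSeqRep μ (fun i => (c i).1) ∧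
      IsSeqRep ν (fun i => (c i).2) ∧ ∀ i, c i ∈ M := by
  obtain ⟨l, rfl⟩ : ∃ l : List _, M = l := ⟨M.toList, M.coe_toList.symm⟩
  have hl : (Finset.univ.val.map l.get : Multiset _) = (l : Multiset _) := by
    simp
  refine ⟨l.length, l.get, ?_, ?_, fun i => by simp⟩
  · rw [isSeqRep_iff_isRep]
    rwa [← hl, Multiset.map_map] at h₁
  · rw [isSeqRep_iff_isRep]
    rwa [← hl, Multiset.map_map] at h₂

lemma bottleneck_nonneg (μ ν : PersDiag) : 0 ≤ bottleneck μ ν := by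
  refine Real.sInf_nonneg ?_
  rintro r ⟨k, a, b, σ, -, -, rfl⟩
  exact Real.iSup_nonneg fun i => (supDist_eq_dist _ _).ge.trans' dist_nonneg

lemma bottleneck_lt_iff {μ ν : PersDiag} {r : ℝ} (hr : 0 < r) :
    bottleneck μ ν < r ↔ ∃ M, IsMatching μ ν r M := by
  constructor
  · intro h
    obtain ⟨_, ⟨k, a, b, σ, ha, hb, rfl⟩, hlt⟩ := exists_lt_of_csInf_lt (by
      obtain ⟨k, c, h₁, h₂, -⟩ := exists_seqRep (μ := μ) (ν := ν)
        (M := μ.toMultiset.map (fun p => (p, diagProj p)) +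
          ν.toMultiset.map (fun p => (diagProj p, p))) (by
          simpa [Multiset.map_map, Function.comp_def] using
            μ.isRep_toMultiset.add_diag (t := ν.toMultiset.map diagProj) (by
              simp only [Multiset.mem_map]
              rintro _ ⟨p, hp, rfl⟩
              exact diagProj_mem (ν.isRep_toMultiset.1 p hp))) (by
          rw [Multiset.map_add, add_comm]
          simpa [Multiset.map_map, Function.comp_def] using
            ν.isRep_toMultiset.add_diag (t := μ.toMultiset.map diagProj) (by
              simp only [Multiset.mem_map]
              rintro _ ⟨p, hp, rfl⟩
              exact diagProj_mem (μ.isRep_toMultiset.1 p hp)))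
      exact ⟨_, k, _, _, Equiv.refl _, h₁, h₂, rfl⟩) h
    rw [isSeqRep_iff_isRep] at ha hb
    refine ⟨Finset.univ.val.map fun i => (a i, b (σ i)), ?_, ?_, ?_⟩
    · simpa [Multiset.map_map, Function.comp_def] using ha
    · have : (Finset.univ.val.map fun i => b (σ i)) = Finset.univ.val.map b := by
        rw [← Function.comp_def, ← Multiset.map_map, Multiset.map_univ_val_equiv]
      rwa [Multiset.map_map, Function.comp_def, this]
    · simp only [Multiset.mem_map]
      rintro _ ⟨i, -, rfl⟩
      exact (le_ciSup (f := fun i => supDist (a i) (b (σ i))) (Set.finite_range _).bddAbove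
        i).trans_lt hlt
  · rintro ⟨M, h₁, h₂, h⟩
    obtain ⟨k, c, hc₁, hc₂, hc⟩ := exists_seqRep h₁ h₂
    refine csInf_lt_of_lt ⟨0, ?_⟩ ⟨k, _, _, Equiv.refl _, hc₁, hc₂, rfl⟩ ?_
    · rintro r ⟨k, a, b, σ, -, -, rfl⟩
      exact Real.iSup_nonneg fun i => (supDist_eq_dist _ _).ge.trans' dist_nonneg
    · rcases isEmpty_or_nonempty (Fin k) with hk | hk
      · rwa [Real.iSup_of_isEmpty]
      · obtain ⟨i, hi⟩ := exists_eq_ciSup_of_finite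
          (f := fun i => supDist (c i).1 (c ((Equiv.refl (Fin k)) i)).2)
        rw [← hi]
        exact h _ (hc i)

/-! ### The bottleneck distance is a metric -/

lemma IsMatching.symm {μ ν : PersDiag} {r : ℝ} {M : Multiset ((ℝ × ℝ) × (ℝ × ℝ))}
    (h : IsMatching μ ν r M) : IsMatching ν μ r (M.map Prod.swap) where
  fst := by simpa [Multiset.map_map, Function.comp_def] using h.snd
  snd := by simpa [Multiset.map_map, Function.comp_def] using h.fst
  dist_lt z hz := by
    obtain ⟨w, hw, rfl⟩ := Multiset.mem_map.1 hz
    simpa [dist_comm] using h.dist_lt w hw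

lemma isMatching_refl (μ : PersDiag) {r : ℝ} (hr : 0 < r) :
    IsMatching μ μ r (μ.toMultiset.map fun p => (p, p)) where
  fst := by simpa [Multiset.map_map, Function.comp_def] using μ.isRep_toMultiset
  snd := by simpa [Multiset.map_map, Function.comp_def] using μ.isRep_toMultiset
  dist_lt z hz := by
    obtain ⟨w, hw, rfl⟩ := Multiset.mem_map.1 hz
    simpa using hr

lemma exists_glue {α β γ : Type*} (M : Multiset (α × β)) :
    ∀ N : Multiset (β × γ), M.map Prod.snd = N.map Prod.fst →
    ∃ W : Multiset (α × β × γ), W.map (fun w => (w.1, w.2.1)) = M ∧ W.map Prod.snd = N := by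
  induction M using Multiset.induction_on with
  | empty =>
    intro N h
    exact ⟨0, rfl, by simpa using (Multiset.map_eq_zero.1 h.symm).symm⟩
  | cons z M ih =>
    intro N h
    obtain ⟨w, hw, hwz⟩ := Multiset.mem_map.1
      (show z.2 ∈ N.map Prod.fst by rw [← h]; simp)
    obtain ⟨N, rfl⟩ := Multiset.exists_cons_of_mem hw
    obtain ⟨W, rfl, rfl⟩ := ih N (by simpa [hwz] using h)
    exact ⟨(z.1, w) ::ₘ W, by simp [hwz], by simp⟩

open Classical in
lemma IsMatching.trans {μ ν ρ : PersDiag} {r s : ℝ} (hr : 0 < r) (hs : 0 < s)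
    {M N : Multiset ((ℝ × ℝ) × (ℝ × ℝ))}
    (h : IsMatching μ ν r M) (h' : IsMatching ν ρ s N) : ∃ W, IsMatching μ ρ (r + s) W := by
  have hM := Multiset.filter_add_not (fun z : (ℝ × ℝ) × (ℝ × ℝ) => z.2 ∈ offDiag) M
  have hN := Multiset.filter_add_not (fun z : (ℝ × ℝ) × (ℝ × ℝ) => z.1 ∈ offDiag) N
  set M₁ := M.filter fun z => z.2 ∈ offDiag
  set M₂ := M.filter fun z => z.2 ∉ offDiag with hM₂
  set N₁ := N.filter fun z => z.1 ∈ offDiag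
  set N₂ := N.filter fun z => z.1 ∉ offDiag with hN₂
  have hd : ∀ z ∈ M₂, z.2 ∈ diagSet := fun z hz => by
    rw [hM₂, Multiset.mem_filter] at hz
    exact mem_diagSet_of_notMem_offDiag (h.snd.1 _ (Multiset.mem_map_of_mem _ hz.1)) hz.2
  have hd' : ∀ z ∈ N₂, z.1 ∈ diagSet := fun z hz => by
    rw [hN₂, Multiset.mem_filter] at hz
    exact mem_diagSet_of_notMem_offDiag (h'.fst.1 _ (Multiset.mem_map_of_mem _ hz.1)) hz.2
  obtain ⟨W, hW₁, hW₂⟩ := exists_glue M₁ N₁ (by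
    have h₁ := h.snd.filter_eq
    rw [← h'.fst.filter_eq, Multiset.filter_map, Multiset.filter_map] at h₁
    exact h₁)
  have e₁ : W.map (fun w => w.1) = M₁.map Prod.fst := by
    rw [← hW₁, Multiset.map_map]; rfl
  have e₂ : W.map (fun w => w.2.2) = N₁.map Prod.snd := by
    rw [← hW₂, Multiset.map_map]; rfl
  refine ⟨W.map (fun w => (w.1, w.2.2)) + M₂ + N₂, ?_, ?_, ?_⟩
  · simp only [Multiset.map_add, Multiset.map_map, Function.comp_def]
    rw [e₁, ← Multiset.map_add, hM]
    refine h.fst.add_diag fun p hp => ?_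
    obtain ⟨z, hz, rfl⟩ := Multiset.mem_map.1 hp
    exact hd' z hz
  · simp only [Multiset.map_add, Multiset.map_map, Function.comp_def]
    rw [e₂, add_right_comm, ← Multiset.map_add, hN]
    refine h'.snd.add_diag fun p hp => ?_
    obtain ⟨z, hz, rfl⟩ := Multiset.mem_map.1 hp
    exact hd z hz
  · intro z hz
    simp only [Multiset.mem_add, Multiset.mem_map] at hz
    rcases hz with (⟨w, hw, rfl⟩ | hz) | hz
    · have a₁ := h.dist_lt (w.1, w.2.1) (by
        rw [← hM, ← hW₁]; exact Multiset.mem_add.2 (.inl (Multiset.mem_map.2 ⟨w, hw, rfl⟩)))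
      have a₂ := h'.dist_lt w.2 (by
        rw [← hN, ← hW₂]; exact Multiset.mem_add.2 (.inl (Multiset.mem_map.2 ⟨w, hw, rfl⟩)))
      exact (dist_triangle _ w.2.1 _).trans_lt (add_lt_add a₁ a₂)
    · exact (h.dist_lt z (Multiset.mem_of_mem_filter hz)).trans (by linarith)
    · exact (h'.dist_lt z (Multiset.mem_of_mem_filter hz)).trans (by linarith)

lemma bottleneck_self (μ : PersDiag) : bottleneck μ μ = 0 :=
  le_antisymm (le_of_forall_gt fun _ hr => (bottleneck_lt_iff hr).2 ⟨_, μ.isMatching_refl hr⟩)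
    (bottleneck_nonneg μ μ)

lemma bottleneck_comm (μ ν : PersDiag) : bottleneck μ ν = bottleneck ν μ := by
  have key : ∀ μ ν : PersDiag, bottleneck μ ν ≤ bottleneck ν μ := fun μ ν =>
    le_of_forall_gt fun r hr => by
      have hr₀ := (bottleneck_nonneg _ _).trans_lt hr
      obtain ⟨M, hM⟩ := (bottleneck_lt_iff hr₀).1 hr
      exact (bottleneck_lt_iff hr₀).2 ⟨_, hM.symm⟩
  exact le_antisymm (key μ ν) (key ν μ)

lemma bottleneck_triangle (μ ν ρ : PersDiag) :
    bottleneck μ ρ ≤ bottleneck μ ν + bottleneck ν ρ := by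
  refine le_of_forall_pos_lt_add fun ε hε => ?_
  have h₁ := bottleneck_nonneg μ ν
  have h₂ := bottleneck_nonneg ν ρ
  obtain ⟨M, hM⟩ := (bottleneck_lt_iff (by linarith)).1
    (show bottleneck μ ν < bottleneck μ ν + ε / 2 by linarith)
  obtain ⟨N, hN⟩ := (bottleneck_lt_iff (by linarith)).1
    (show bottleneck ν ρ < bottleneck ν ρ + ε / 2 by linarith)
  obtain ⟨W, hW⟩ := hM.trans (by linarith) (by linarith) hN
  exact ((bottleneck_lt_iff (by linarith)).2 ⟨W, hW⟩).trans_le (by linarith)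

lemma exists_pos_isolating (S : Set (ℝ × ℝ)) (hS : S.Finite) (p : ℝ × ℝ) :
    ∃ r > 0, ∀ q ∈ S, dist p q < r → q = p := by
  have := (hS.subset Set.sdiff_subset : (S \ {p}).Finite).isClosed
  obtain ⟨r, hr, h⟩ := Metric.isOpen_iff.1 this.isOpen_compl p (by simp)
  refine ⟨r, hr, fun q hq hd => ?_⟩
  by_contra hne
  exact h (by rwa [Metric.mem_ball, dist_comm]) ⟨hq, hne⟩

lemma half_persistence_le_dist {p z : ℝ × ℝ} (hz : z ∈ diagSet) :
    |p.2 - p.1| / 2 ≤ dist p z := by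
  have h₁ : |p.1 - z.1| ≤ dist p z := le_max_left _ _
  have h₂ : |p.2 - z.2| ≤ dist p z := le_max_right _ _
  have := hz.2
  have := abs_le.1 h₁
  have := abs_le.1 h₂
  rw [div_le_iff₀ two_pos, abs_le]
  constructor <;> linarith

lemma toFun_le_of_bottleneck_eq_zero {μ ν : PersDiag} (h : bottleneck μ ν = 0) {p : ℝ × ℝ}
    (hp : p ∈ offDiag) : μ.toFun p ≤ ν.toFun p := by
  classical
  obtain ⟨r, hr, hiso⟩ := exists_pos_isolating _ ν.finite_support p
  have hr' : 0 < min r ((p.2 - p.1) / 2) := lt_min hr (by have := hp.2; linarith)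
  obtain ⟨M, hM⟩ := (bottleneck_lt_iff hr').1 (h ▸ hr')
  rw [← hM.fst.2 p hp, ← hM.snd.2 p hp, Multiset.count_map, Multiset.count_map]
  refine Multiset.card_le_card (Multiset.le_filter.2 ⟨Multiset.filter_le _ _, fun z hz => ?_⟩)
  obtain ⟨hzM, rfl⟩ := Multiset.mem_filter.1 hz
  have hd := lt_min_iff.1 (hM.dist_lt z hzM)
  have hz₂ := Multiset.mem_map_of_mem Prod.snd hzM
  refine (hiso z.2 (hM.snd.mem_support hz₂ ?_) hd.1).symm
  by_contra hoff
  exact (hd.2.trans_le (div_le_div_of_nonneg_right (le_abs_self _) two_pos.le)).not_ge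
    (half_persistence_le_dist (mem_diagSet_of_notMem_offDiag (hM.snd.1 _ hz₂) hoff))

instance : MetricSpace PersDiag :=
  letI m : MetricSpace PersDiag :=
    { dist := bottleneck
      dist_self := bottleneck_self
      dist_comm := bottleneck_comm
      dist_triangle := bottleneck_triangle
      eq_of_dist_eq_zero := fun {μ ν} h => ext fun _ hp =>
        le_antisymm (toFun_le_of_bottleneck_eq_zero h hp)
          (toFun_le_of_bottleneck_eq_zero ((bottleneck_comm ν μ).trans h) hp) }
  m.replaceTopology <| by
    refine le_antisymm (fun U hU => ?_) (le_generateFrom ?_)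
    · have hU' := @Metric.isOpen_iff _ m.toPseudoMetricSpace U |>.1 hU
      refine @isOpen_iff_forall_mem_open _ _ (_) |>.2 fun μ hμ => ?_
      obtain ⟨ε, hε, h⟩ := hU' μ hμ
      exact ⟨{ν | bottleneck μ ν < ε},
        fun ν hν => h ((bottleneck_comm ν μ).trans_lt hν),
        TopologicalSpace.isOpen_generateFrom_of_mem ⟨μ, ε, hε, rfl⟩,
        (bottleneck_self μ).trans_lt hε⟩
    · rintro _ ⟨μ, ε, -, rfl⟩
      have : {ν | bottleneck μ ν < ε} = @Metric.ball _ m.toPseudoMetricSpace μ ε := by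
        ext ν
        exact iff_of_eq (congrArg (· < ε) (bottleneck_comm μ ν))
      rw [this]
      exact @Metric.isOpen_ball _ m.toPseudoMetricSpace μ ε

lemma dist_lt_iff {μ ν : PersDiag} {r : ℝ} (hr : 0 < r) :
    dist μ ν < r ↔ ∃ M, IsMatching μ ν r M :=
  bottleneck_lt_iff hr

/-! ### Superposition and pushforward of diagrams -/

/-- Superposition of diagrams. -/
def superpose (μ ν : PersDiag) : PersDiag where
  toFun p := μ.toFun p + ν.toFun p
  finite_support := (μ.finite_support.union ν.finite_support).subset (Function.support_add _ _)
  support_subset := (Function.support_add _ _).trans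
    (Set.union_subset μ.support_subset ν.support_subset)

lemma IsRep.superpose {μ ν : PersDiag} {s t : Multiset (ℝ × ℝ)} (hs : μ.IsRep s)
    (ht : ν.IsRep t) : (μ.superpose ν).IsRep (s + t) := by
  refine ⟨fun p hp => ?_, fun p hp => ?_⟩
  · exact (Multiset.mem_add.1 hp).elim (hs.1 p) (ht.1 p)
  · rw [Multiset.count_add, hs.2 p hp, ht.2 p hp]; rfl

lemma dist_superpose_lt {μ μ' ν ν' : PersDiag} {r : ℝ} (h : dist μ μ' < r) (h' : dist ν ν' < r) :
    dist (μ.superpose ν) (μ'.superpose ν') < r := by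
  have hr := dist_nonneg.trans_lt h
  obtain ⟨M, hM⟩ := (dist_lt_iff hr).1 h
  obtain ⟨N, hN⟩ := (dist_lt_iff hr).1 h'
  refine (dist_lt_iff hr).2 ⟨M + N, ?_, ?_, fun z hz => ?_⟩
  · simpa using hM.fst.superpose hN.fst
  · simpa using hM.snd.superpose hN.snd
  · exact (Multiset.mem_add.1 hz).elim (hM.dist_lt z) (hN.dist_lt z)

/-- Pushforward of a diagram along a self-map of the plane. -/
def push (c : ℝ × ℝ → ℝ × ℝ) (μ : PersDiag) : PersDiag := ofMultiset (μ.toMultiset.map c)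

/-- A self-map of `(X ∪ Δ, Δ)`. -/
structure PreservesDiag (c : ℝ × ℝ → ℝ × ℝ) : Prop where
  upper : ∀ p ∈ upperRegion, c p ∈ upperRegion
  diag : ∀ p ∈ diagSet, c p ∈ diagSet

lemma IsRep.push {c : ℝ × ℝ → ℝ × ℝ} (hc : PreservesDiag c) {μ : PersDiag}
    {s : Multiset (ℝ × ℝ)} (h : μ.IsRep s) : (push c μ).IsRep (s.map c) := by
  classical
  rw [← Multiset.filter_add_not (· ∈ offDiag) s, h.filter_eq, Multiset.map_add]
  refine (isRep_ofMultiset fun p hp => ?_).add_diag fun p hp => ?_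
  · obtain ⟨q, hq, rfl⟩ := Multiset.mem_map.1 hp
    exact hc.upper q (μ.isRep_toMultiset.1 q hq)
  · obtain ⟨q, hq, rfl⟩ := Multiset.mem_map.1 hp
    rw [Multiset.mem_filter] at hq
    exact hc.diag q (mem_diagSet_of_notMem_offDiag (h.1 q hq.1) hq.2)

lemma support_push_subset (c : ℝ × ℝ → ℝ × ℝ) (μ : PersDiag) :
    Function.support (push c μ).toFun ⊆ c '' Function.support μ.toFun := by
  intro p hp
  have h : p ∈ μ.toMultiset.map c := by
    by_contra h
    simp [push, ofMultiset, Multiset.count_eq_zero.2 h] at hp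
  obtain ⟨q, hq, rfl⟩ := Multiset.mem_map.1 h
  exact ⟨q, mem_toMultiset.1 hq, rfl⟩

lemma push_mem_DD {n : ℕ} {c : ℝ × ℝ → ℝ × ℝ} (hc : ∀ p ∈ triangle n, c p ∈ triangle n)
    {μ : PersDiag} (hμ : μ ∈ DD n) : push c μ ∈ DD n := by
  refine ⟨(Set.ncard_le_ncard (support_push_subset c μ) (μ.finite_support.image c)).trans
    ((Set.ncard_image_le μ.finite_support).trans hμ.1), (support_push_subset c μ).trans ?_⟩
  rintro _ ⟨q, hq, rfl⟩
  exact hc q (hμ.2 hq)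

lemma IsMatching.push {μ ν : PersDiag} {r s : ℝ} {M : Multiset ((ℝ × ℝ) × (ℝ × ℝ))}
    (h : IsMatching μ ν r M) {c c' : ℝ × ℝ → ℝ × ℝ} (hc : PreservesDiag c)
    (hc' : PreservesDiag c') (hs : ∀ z ∈ M, dist (c z.1) (c' z.2) < s) :
    IsMatching (push c μ) (push c' ν) s (M.map (Prod.map c c')) where
  fst := by simpa [Multiset.map_map, Function.comp_def] using h.fst.push hc
  snd := by simpa [Multiset.map_map, Function.comp_def] using h.snd.push hc'
  dist_lt z hz := by
    obtain ⟨w, hw, rfl⟩ := Multiset.mem_map.1 hz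
    exact hs w hw

lemma IsRep.mem_support_or_diag {μ : PersDiag} {s : Multiset (ℝ × ℝ)} (h : μ.IsRep s)
    {p : ℝ × ℝ} (hp : p ∈ s) : p ∈ Function.support μ.toFun ∪ diagSet := by
  by_cases hp' : p ∈ offDiag
  · exact .inl (h.mem_support hp hp')
  · exact .inr (mem_diagSet_of_notMem_offDiag (h.1 p hp) hp')

/-! ### Sliding the points of a diagram -/

open unitInterval

/-- Move every point `p` of the plane along the segment towards `a p`. -/
def slide (a : ℝ × ℝ → ℝ × ℝ) (t : I) (p : ℝ × ℝ) : ℝ × ℝ := (1 - t : ℝ) • p + (t : ℝ) • a p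

lemma slide_zero (a : ℝ × ℝ → ℝ × ℝ) : slide a 0 = id := by
  ext p <;> simp [slide]

lemma slide_one (a : ℝ × ℝ → ℝ × ℝ) : slide a 1 = a := by
  ext p <;> simp [slide]

lemma slide_mem {a : ℝ × ℝ → ℝ × ℝ} {s : Set (ℝ × ℝ)} (hs : Convex ℝ s) (t : I) {p : ℝ × ℝ}
    (hp : p ∈ s) (ha : a p ∈ s) : slide a t p ∈ s :=
  hs hp ha (sub_nonneg.2 t.2.2) t.2.1 (by ring)

lemma convex_upperRegion : Convex ℝ upperRegion := by
  intro p hp q hq a b ha hb hab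
  obtain ⟨hp₁, hp₂⟩ := hp
  obtain ⟨hq₁, hq₂⟩ := hq
  refine ⟨?_, ?_⟩ <;> simp only [Prod.fst_add, Prod.snd_add, Prod.smul_fst, Prod.smul_snd,
    smul_eq_mul]
  · positivity
  · gcongr

lemma convex_diagSet : Convex ℝ diagSet := by
  intro p hp q hq a b ha hb hab
  obtain ⟨hp₁, hp₂⟩ := hp
  obtain ⟨hq₁, hq₂⟩ := hq
  refine ⟨?_, ?_⟩ <;> simp only [Prod.fst_add, Prod.snd_add, Prod.smul_fst, Prod.smul_snd,
    smul_eq_mul]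
  · positivity
  · rw [hp₂, hq₂]

lemma convex_triangle (n : ℕ) : Convex ℝ (triangle n) := by
  intro p hp q hq a b ha hb hab
  obtain ⟨hp₁, hp₂, hp₃⟩ := hp
  obtain ⟨hq₁, hq₂, hq₃⟩ := hq
  refine ⟨?_, ?_, ?_⟩ <;> simp only [Prod.fst_add, Prod.snd_add, Prod.smul_fst, Prod.smul_snd,
    smul_eq_mul]
  · positivity
  · gcongr
  · calc a * p.2 + b * q.2 ≤ a * n + b * n := by gcongr
      _ = n := by rw [← add_mul, hab, one_mul]

lemma PreservesDiag.slide {a : ℝ × ℝ → ℝ × ℝ} (ha : PreservesDiag a) (t : I) :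
    PreservesDiag (slide a t) :=
  ⟨fun p hp => slide_mem convex_upperRegion t hp (ha.upper p hp),
    fun p hp => slide_mem convex_diagSet t hp (ha.diag p hp)⟩

lemma push_id (μ : PersDiag) : push id μ = μ := by
  have h : (push id μ).IsRep (μ.toMultiset.map id) :=
    μ.isRep_toMultiset.push ⟨fun _ h => h, fun _ h => h⟩
  rw [Multiset.map_id] at h
  exact h.unique μ.isRep_toMultiset

lemma dist_slide_slide_le {a : ℝ × ℝ → ℝ × ℝ} {p q : ℝ × ℝ} (s t : I) :
    dist (slide a s p) (slide a t q) ≤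
      max (dist p q) (dist (a p) (a q)) + dist s t * dist q (a q) := by
  have h₁ : dist (slide a s p) (slide a s q) ≤ max (dist p q) (dist (a p) (a q)) := by
    refine (dist_add_add_le _ _ _ _).trans ?_
    rw [dist_smul₀, dist_smul₀, Real.norm_of_nonneg (sub_nonneg.2 s.2.2), Real.norm_of_nonneg s.2.1]
    calc _ ≤ (1 - s : ℝ) * max (dist p q) (dist (a p) (a q)) +
          s * max (dist p q) (dist (a p) (a q)) := by
            gcongr
            · exact sub_nonneg.2 s.2.2
            · exact le_max_left _ _
            · exact s.2.1
            · exact le_max_right _ _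
      _ = _ := by ring
  have h₂ : dist (slide a s q) (slide a t q) = dist s t * dist q (a q) := by
    rw [dist_eq_norm, Subtype.dist_eq, Real.dist_eq, dist_comm, dist_eq_norm, ← Real.norm_eq_abs,
      ← norm_smul]
    congr 1
    simp only [slide]
    module
  exact (dist_triangle _ _ _).trans (add_le_add h₁ h₂.le)

lemma continuousOn_push_slide {a : ℝ × ℝ → ℝ × ℝ} (ha : PreservesDiag a) {Z : Set (ℝ × ℝ)}
    (hZ : diagSet ⊆ Z) {ρ D : ℝ} (hρ : 0 < ρ) (hD : 0 ≤ D)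
    (hlip : ∀ p ∈ Z, ∀ q ∈ Z, dist p q < ρ → dist (a p) (a q) ≤ dist p q)
    (hdist : ∀ p ∈ Z, dist p (a p) ≤ D) :
    ContinuousOn (fun x : PersDiag × I => push (slide a x.2) x.1)
      ({μ | Function.support μ.toFun ⊆ Z} ×ˢ Set.univ) := by
  rw [Metric.continuousOn_iff]
  rintro ⟨μ, t⟩ ⟨hμ, -⟩ ε hε
  refine ⟨min ρ (ε / (1 + D)), by positivity, ?_⟩
  rintro ⟨ν, s⟩ ⟨hν, -⟩ h
  rw [Prod.dist_eq, max_lt_iff] at h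
  obtain ⟨M, hM⟩ := (dist_lt_iff (by positivity)).1 h.1
  refine (dist_lt_iff hε).2 ⟨_, hM.push (ha.slide s) (ha.slide t) fun z hz => ?_⟩
  have hz₁ : z.1 ∈ Z := Set.union_subset hν hZ
    (hM.fst.mem_support_or_diag (Multiset.mem_map_of_mem _ hz))
  have hz₂ : z.2 ∈ Z := Set.union_subset hμ hZ
    (hM.snd.mem_support_or_diag (Multiset.mem_map_of_mem _ hz))
  have hd := lt_min_iff.1 (hM.dist_lt z hz)
  have hst : dist s t ≤ ε / (1 + D) := (h.2.trans_le (min_le_right _ _)).le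
  calc _ ≤ _ := dist_slide_slide_le s t
    _ ≤ dist z.1 z.2 + ε / (1 + D) * D := by
      gcongr
      · exact max_le le_rfl (hlip _ hz₁ _ hz₂ hd.1)
      · exact hdist _ hz₂
    _ < ε / (1 + D) + ε / (1 + D) * D := by gcongr; exact hd.2
    _ = ε := by field_simp

lemma preservesDiag_diagProj : PreservesDiag diagProj :=
  ⟨fun _ hp => diagSet_subset_upperRegion (diagProj_mem hp),
    fun _ hp => diagProj_mem (diagSet_subset_upperRegion hp)⟩

lemma diagProj_mem_triangle {n : ℕ} {p : ℝ × ℝ} (hp : p ∈ triangle n) :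
    diagProj p ∈ triangle n := by
  obtain ⟨h₁, h₂, h₃⟩ := hp
  refine ⟨?_, ?_, ?_⟩ <;> simp only [diagProj] <;> linarith

lemma dist_diagProj_diagProj_le (p q : ℝ × ℝ) : dist (diagProj p) (diagProj q) ≤ dist p q := by
  have h₁ : |p.1 - q.1| ≤ dist p q := le_max_left _ _
  have h₂ : |p.2 - q.2| ≤ dist p q := le_max_right _ _
  rw [abs_le] at h₁ h₂
  rw [Prod.dist_eq, diagProj, diagProj, max_self, Real.dist_eq, abs_le]
  constructor <;> linarith

lemma dist_diagProj (p : ℝ × ℝ) : dist p (diagProj p) = |p.2 - p.1| / 2 := by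
  rw [Prod.dist_eq, diagProj, Real.dist_eq, Real.dist_eq,
    show p.1 - (p.1 + p.2) / 2 = -((p.2 - p.1) / 2) by ring,
    show p.2 - (p.1 + p.2) / 2 = (p.2 - p.1) / 2 by ring, abs_neg, max_self, abs_div, abs_two]

lemma diagProj_eq_self {p : ℝ × ℝ} (hp : p ∈ diagSet) : diagProj p = p := by
  have := hp.2
  ext <;> simp only [diagProj] <;> linarith

/-- The sliding homotopy restricted to `𝒟ₙ`. -/
def slideDD {n : ℕ} (a : ℝ × ℝ → ℝ × ℝ) (ha : ∀ p ∈ triangle n, a p ∈ triangle n)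
    (μ : DD n) (t : I) : DD n :=
  ⟨push (slide a t) μ.1, push_mem_DD (fun p hp => slide_mem (convex_triangle n) t hp (ha p hp)) μ.2⟩

lemma slideDD_zero {n : ℕ} {a : ℝ × ℝ → ℝ × ℝ} (ha : ∀ p ∈ triangle n, a p ∈ triangle n)
    (μ : DD n) : slideDD a ha μ 0 = μ :=
  Subtype.ext ((congrArg (push · μ.1) (slide_zero a)).trans (push_id _))

/-- The empty diagram. -/
def empty : PersDiag := ofMultiset 0

lemma empty_mem_DD (n : ℕ) : empty ∈ DD n := by
  have : Function.support empty.toFun = ∅ := by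
    ext p; simp [empty, ofMultiset]
  constructor <;> rw [this] <;> simp

lemma push_eq_empty {c : ℝ × ℝ → ℝ × ℝ} (hc : ∀ p ∈ upperRegion, c p ∈ diagSet) (μ : PersDiag) :
    push c μ = empty := by
  have h := μ.isRep_toMultiset.push
    ⟨fun p hp => diagSet_subset_upperRegion (hc p hp),
      fun p hp => hc p (diagSet_subset_upperRegion hp)⟩
  refine h.unique ?_
  have h₀ : empty.IsRep 0 := isRep_ofMultiset (by simp)
  have h₁ := h₀.add_diag (t := μ.toMultiset.map c) fun p hp => by
    obtain ⟨q, hq, rfl⟩ := Multiset.mem_map.1 hp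
    exact hc q (μ.isRep_toMultiset.1 q hq)
  rwa [zero_add] at h₁

lemma exists_contraction_DD (n : ℕ) : ∃ (μ₀ : DD n) (h : DD n → I → DD n),
    Continuous (Function.uncurry h) ∧ (∀ μ, h μ 0 = μ) ∧ ∀ μ, h μ 1 = μ₀ := by
  refine ⟨⟨empty, empty_mem_DD n⟩, slideDD diagProj fun _ => diagProj_mem_triangle, ?_,
    slideDD_zero _, fun μ => Subtype.ext ?_⟩
  · refine Continuous.subtype_mk ?_ _
    refine (continuousOn_push_slide preservesDiag_diagProj
      (Z := triangle n ∪ diagSet) Set.subset_union_right one_pos (D := n) (by positivity)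
      (fun p _ q _ _ => dist_diagProj_diagProj_le p q) ?_).comp_continuous
      (f := fun x : DD n × I => (x.1.1, x.2)) (by fun_prop)
      fun x => ⟨x.1.2.2.trans Set.subset_union_left, trivial⟩
    rintro p (⟨h₁, h₂, h₃⟩ | hp)
    · rw [dist_diagProj, abs_of_nonneg (by linarith)]
      linarith
    · rw [diagProj_eq_self hp, dist_self]; positivity
  · change push (slide diagProj 1) μ.1 = empty
    rw [slide_one]
    exact push_eq_empty (fun p hp => diagProj_mem hp) _

/-- The points of `μ` have distance at least `4 * ρ` from each other and from the diagonal. -/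
def IsSeparated (μ : PersDiag) (ρ : ℝ) : Prop :=
  ∀ p ∈ Function.support μ.toFun, ∀ q ∈ Function.support μ.toFun ∪ diagSet,
    dist p q < 4 * ρ → q = p

lemma exists_isSeparated (μ : PersDiag) : ∃ ρ > 0, μ.IsSeparated ρ := by
  have key : ∀ p ∈ Function.support μ.toFun, ∀ᶠ ρ : ℝ in 𝓝[>] 0,
      ∀ q ∈ Function.support μ.toFun ∪ diagSet, dist p q < 4 * ρ → q = p := by
    intro p hp
    obtain ⟨r, hr, hiso⟩ := exists_pos_isolating _ μ.finite_support p
    have hpers := (μ.support_subset hp).2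
    have h₁ : ∀ᶠ ρ : ℝ in 𝓝[>] 0, ρ < min (r / 4) (|p.2 - p.1| / 8) :=
      mem_nhdsWithin_of_mem_nhds (eventually_lt_nhds
        (lt_min (by positivity) (by have := abs_pos.2 (sub_pos.2 hpers).ne'; positivity)))
    filter_upwards [h₁] with ρ hρ q hq hd
    rw [lt_min_iff] at hρ
    rcases hq with hq | hq
    · exact hiso q hq (by linarith)
    · have := half_persistence_le_dist (p := p) hq
      linarith
  obtain ⟨ρ, h, hρ⟩ := (((Filter.eventually_all_finite μ.finite_support).2 key).and
    (eventually_mem_nhdsWithin)).exists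
  exact ⟨ρ, hρ, h⟩

open Classical in
/-- The points of `S` attract their neighbourhoods, all other points go to the diagonal. -/
def attractor (S : Set (ℝ × ℝ)) (ρ : ℝ) (q : ℝ × ℝ) : ℝ × ℝ :=
  if h : ∃ p ∈ S, dist q p < ρ then h.choose else diagProj q

section attractor

variable {μ : PersDiag} {ρ : ℝ}

lemma attractor_of_near_support (hsep : μ.IsSeparated ρ) {p q : ℝ × ℝ}
    (hp : p ∈ Function.support μ.toFun) (hq : dist q p < ρ) :
    attractor (Function.support μ.toFun) ρ q = p := by
  have h : ∃ p ∈ Function.support μ.toFun, dist q p < ρ := ⟨p, hp, hq⟩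
  rw [attractor, dif_pos h]
  refine hsep p hp _ (.inl h.choose_spec.1) ?_
  have := h.choose_spec.2
  have := dist_triangle_left p h.choose q
  have := dist_nonneg (x := q) (y := p)
  linarith

lemma attractor_of_near_diag (hsep : μ.IsSeparated ρ) {z q : ℝ × ℝ}
    (hz : z ∈ diagSet) (hq : dist q z < ρ) :
    attractor (Function.support μ.toFun) ρ q = diagProj q := by
  refine dif_neg ?_
  rintro ⟨p, hp, hqp⟩
  have := dist_triangle_left p z q
  have := dist_nonneg (x := q) (y := p)
  have h := hsep p hp z (.inr hz) (by linarith)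
  exact notMem_offDiag_of_mem_diagSet hz (h ▸ μ.support_subset hp)

lemma dist_attractor_le (hsep : μ.IsSeparated ρ) {z q : ℝ × ℝ}
    (hz : z ∈ Function.support μ.toFun ∪ diagSet) (hq : dist q z < ρ) :
    dist (attractor (Function.support μ.toFun) ρ q) z ≤ dist q z ∧
      dist q (attractor (Function.support μ.toFun) ρ q) ≤ ρ := by
  rcases hz with hz | hz
  · rw [attractor_of_near_support hsep hz hq, dist_self]
    exact ⟨dist_nonneg, hq.le⟩
  · rw [attractor_of_near_diag hsep hz hq]
    refine ⟨?_, ?_⟩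
    · simpa [diagProj_eq_self hz] using dist_diagProj_diagProj_le q z
    · rw [dist_diagProj]
      exact (half_persistence_le_dist hz).trans hq.le

lemma dist_attractor_attractor_le (hsep : μ.IsSeparated ρ) {z z' q q' : ℝ × ℝ}
    (hz : z ∈ Function.support μ.toFun ∪ diagSet) (hz' : z' ∈ Function.support μ.toFun ∪ diagSet)
    (hq : dist q z < ρ) (hq' : dist q' z' < ρ) (h : dist q q' < ρ) :
    dist (attractor (Function.support μ.toFun) ρ q) (attractor (Function.support μ.toFun) ρ q') ≤
      dist q q' := by
  have hzz : dist z z' < 4 * ρ := by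
    have := dist_triangle4 z q q' z'
    rw [dist_comm z q] at this
    linarith [dist_nonneg.trans_lt h]
  by_cases hS : z ∈ Function.support μ.toFun ∨ z' ∈ Function.support μ.toFun
  · have hzz' : z = z' ∧ z ∈ Function.support μ.toFun := by
      rcases hS with hS | hS
      · have := hsep z hS z' hz' hzz
        exact ⟨this.symm, hS⟩
      · have := hsep z' hS z hz (by rwa [dist_comm])
        exact ⟨this, this ▸ hS⟩
    obtain ⟨rfl, hzS⟩ := hzz'
    rw [attractor_of_near_support hsep hzS hq, attractor_of_near_support hsep hzS hq', dist_self]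
    exact dist_nonneg
  · rw [not_or] at hS
    rw [attractor_of_near_diag hsep (hz.resolve_left hS.1) hq,
      attractor_of_near_diag hsep (hz'.resolve_left hS.2) hq']
    exact dist_diagProj_diagProj_le q q'

lemma preservesDiag_attractor (hsep : μ.IsSeparated ρ) (hρ : 0 < ρ) :
    PreservesDiag (attractor (Function.support μ.toFun) ρ) where
  upper q hq := by
    by_cases h : ∃ p ∈ Function.support μ.toFun, dist q p < ρ
    · obtain ⟨p, hp, hd⟩ := h
      rw [attractor_of_near_support hsep hp hd]
      exact offDiag_subset_upperRegion (μ.support_subset hp)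
    · rw [attractor, dif_neg h]
      exact diagSet_subset_upperRegion (diagProj_mem hq)
  diag q hq := by
    rw [attractor_of_near_diag hsep hq (by rwa [dist_self])]
    exact diagProj_mem (diagSet_subset_upperRegion hq)

lemma attractor_mem_triangle (hsep : μ.IsSeparated ρ) {n : ℕ}
    (hμ : Function.support μ.toFun ⊆ triangle n) {q : ℝ × ℝ} (hq : q ∈ triangle n) :
    attractor (Function.support μ.toFun) ρ q ∈ triangle n := by
  by_cases h : ∃ p ∈ Function.support μ.toFun, dist q p < ρ
  · obtain ⟨p, hp, hd⟩ := h
    rw [attractor_of_near_support hsep hp hd]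
    exact hμ hp
  · rw [attractor, dif_neg h]
    exact diagProj_mem_triangle hq

lemma push_attractor_eq (hsep : μ.IsSeparated ρ) (hρ : 0 < ρ) {ν : PersDiag}
    (h : dist μ ν < ρ) :
    push (attractor (Function.support μ.toFun) ρ) ν = μ := by
  obtain ⟨M, hM⟩ := (dist_lt_iff hρ).1 h
  refine ext fun p hp => ?_
  rw [← (hM.snd.push (preservesDiag_attractor hsep hρ)).2 p hp, ← hM.fst.2 p hp, Multiset.map_map,
    Multiset.count_map, Multiset.count_map]
  refine congrArg _ (Multiset.filter_congr fun z hz => ?_)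
  have hd := (dist_comm _ _).trans_lt (hM.dist_lt z hz)
  rcases hM.fst.mem_support_or_diag (Multiset.mem_map_of_mem _ hz) with hz₁ | hz₁
  · rw [Function.comp_apply, attractor_of_near_support hsep hz₁ hd]
  · rw [Function.comp_apply, attractor_of_near_diag hsep hz₁ hd]
    have h₂ := diagProj_mem (hM.snd.1 _ (Multiset.mem_map_of_mem _ hz))
    constructor
    · rintro rfl; exact (notMem_offDiag_of_mem_diagSet h₂ hp).elim
    · rintro rfl; exact (notMem_offDiag_of_mem_diagSet hz₁ hp).elim

end attractor

/-- Every point of `𝒟ₙ` has arbitrarily small balls which contract within themselves. -/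
lemma exists_local_contraction_DD {n : ℕ} (μ : DD n) {ε : ℝ} (hε : 0 < ε) :
    ∃ δ > 0, δ ≤ ε ∧ ∃ h : DD n → I → DD n,
      ContinuousOn (Function.uncurry h) (Metric.ball μ δ ×ˢ Set.univ) ∧
      (∀ ν, h ν 0 = ν) ∧ (∀ ν ∈ Metric.ball μ δ, h ν 1 = μ) ∧
      ∀ ν ∈ Metric.ball μ δ, ∀ t, h ν t ∈ Metric.ball μ δ := by
  obtain ⟨ρ, hρ, hsep⟩ := μ.1.exists_isSeparated
  set a := attractor (Function.support μ.1.toFun) ρ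
  have ha : PreservesDiag a := preservesDiag_attractor hsep hρ
  have key : ∀ ν ∈ Metric.ball μ (min ρ ε), ∃ M, IsMatching ν.1 μ.1 (min ρ ε) M := fun ν hν =>
    (dist_lt_iff (lt_min hρ hε)).1 hν
  refine ⟨min ρ ε, lt_min hρ hε, min_le_right _ _,
    slideDD a fun _ => attractor_mem_triangle hsep μ.2.2, ?_, slideDD_zero _, ?_, ?_⟩
  · set Z : Set (ℝ × ℝ) := {q | ∃ z ∈ Function.support μ.1.toFun ∪ diagSet, dist q z < ρ}
    rw [Topology.IsInducing.subtypeVal.continuousOn_iff]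
    refine (continuousOn_push_slide ha (Z := Z) (fun z hz => ⟨z, .inr hz, by rwa [dist_self]⟩) hρ
      hρ.le ?_ ?_).comp (f := fun x : DD n × I => (x.1.1, x.2)) (by fun_prop) ?_
    · rintro p ⟨z, hz, hd⟩ q ⟨z', hz', hd'⟩ h
      exact dist_attractor_attractor_le hsep hz hz' hd hd' h
    · rintro p ⟨z, hz, hd⟩
      exact (dist_attractor_le hsep hz hd).2
    · rintro ⟨ν, t⟩ ⟨hν, -⟩
      refine ⟨fun p hp => ?_, trivial⟩
      obtain ⟨M, hM⟩ := key ν hν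
      have hpM : p ∈ M.map Prod.fst := by
        rw [← Multiset.count_pos, hM.fst.2 p (ν.1.support_subset hp)]
        exact Nat.pos_of_ne_zero hp
      obtain ⟨z, hz, rfl⟩ := Multiset.mem_map.1 hpM
      exact ⟨z.2, hM.snd.mem_support_or_diag (Multiset.mem_map_of_mem _ hz),
        (hM.dist_lt z hz).trans_le (min_le_left _ _)⟩
  · intro ν hν
    refine Subtype.ext ?_
    change push (slide a 1) ν.1 = μ.1
    rw [slide_one]
    exact push_attractor_eq hsep hρ ((dist_comm _ _).trans_lt (hν.trans_le (min_le_left _ _)))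
  · intro ν hν t
    obtain ⟨M, hM⟩ := key ν hν
    refine (dist_lt_iff (lt_min hρ hε)).2 ⟨M.map (Prod.map (slide a t) id), ?_⟩
    have := hM.push (ha.slide t) ⟨fun _ h => h, fun _ h => h⟩ (c' := id) (s := min ρ ε) ?_
    · rwa [push_id] at this
    intro z hz
    have hd := hM.dist_lt z hz
    refine slide_mem (convex_ball z.2 (min ρ ε)) t hd ?_
    exact (dist_attractor_le hsep (hM.snd.mem_support_or_diag (Multiset.mem_map_of_mem _ hz))
      (hd.trans_le (min_le_left _ _))).1.trans_lt hd

end PersDiag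

/-! ### Extension of maps into locally contractible spaces -/

section Extension

open unitInterval Metric

/-- Half-size tent functions around the even (`e = false`) or odd (`e = true`) integers. -/
def tent (e : Bool) (u : ℝ) : I :=
  Set.projIcc 0 1 zero_le_one (4 - 10 * |(u - e.toNat) / 2 - round ((u - e.toNat) / 2)|)

/-- The even (`e = false`) or odd (`e = true`) integer closest to `u`. -/
def tentCenter (e : Bool) (u : ℝ) : ℤ := 2 * round ((u - e.toNat) / 2) + e.toNat

lemma continuous_abs_sub_round : Continuous fun u : ℝ => |u - round u| := by
  simp_rw [← UnitAddCircle.norm_eq]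
  exact continuous_norm.comp continuous_quotient_mk'

lemma eventually_round_eq {u : ℝ} (hu : |u - round u| < 1 / 2) :
    ∀ᶠ v : ℝ in 𝓝 u, round v = round u := by
  have : ∀ᶠ v : ℝ in 𝓝 u, |v - round u| < 1 / 2 :=
    (by fun_prop : Continuous fun v : ℝ => |v - round u|).continuousAt.eventually_lt_const hu
  filter_upwards [this] with v hv
  rw [abs_lt] at hv
  rw [round_eq v, Int.floor_eq_iff]
  constructor <;> linarith

lemma continuous_tent (e : Bool) : Continuous (tent e) :=
  continuous_projIcc.comp (continuous_const.sub (continuous_const.mul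
    (continuous_abs_sub_round.comp (by fun_prop : Continuous fun u : ℝ => (u - e.toNat) / 2))))

lemma abs_sub_tentCenter_le (e : Bool) (u : ℝ) : |u - tentCenter e u| ≤ 1 := by
  have h := abs_le.1 (abs_sub_round ((u - e.toNat) / 2))
  rw [tentCenter, abs_le]
  push_cast
  constructor <;> linarith

lemma tent_eq_zero_or_tentCenter_eq (e : Bool) (u : ℝ) :
    (∀ᶠ v in 𝓝 u, tent e v = 0) ∨ ∀ᶠ v in 𝓝 u, tentCenter e v = tentCenter e u := by
  have hc : Continuous fun u : ℝ => (u - e.toNat) / 2 := by fun_prop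
  rcases lt_or_ge |(u - e.toNat) / 2 - round ((u - e.toNat) / 2)| (1 / 2) with h | h
  · right
    filter_upwards [hc.continuousAt.eventually (eventually_round_eq h)] with v hv
    rw [tentCenter, hv, tentCenter]
  · left
    have : ∀ᶠ v : ℝ in 𝓝 u, (2 / 5 : ℝ) < |(v - e.toNat) / 2 - round ((v - e.toNat) / 2)| :=
      (continuous_abs_sub_round.comp hc).continuousAt.eventually_const_lt
        (lt_of_lt_of_le (by norm_num) h)
    filter_upwards [this] with v hv
    exact Set.projIcc_of_le_left _ (by linarith)

lemma exists_tent_eq_one (u : ℝ) : ∃ e, ∀ᶠ v in 𝓝 u, tent e v = 1 := by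
  suffices h : ∃ e : Bool, |(u - e.toNat) / 2 - round ((u - e.toNat) / 2)| < 3 / 10 by
    obtain ⟨e, h⟩ := h
    have hc : Continuous fun u : ℝ => (u - e.toNat) / 2 := by fun_prop
    refine ⟨e, ?_⟩
    filter_upwards [(continuous_abs_sub_round.comp hc).continuousAt.eventually_lt_const h] with v hv
    exact Set.projIcc_of_right_le _ (by simp only [Function.comp_apply] at hv; linarith)
  by_contra! h
  have h₀ := h false
  have h₁ := h true
  simp only [Bool.toNat_false, Bool.toNat_true, Nat.cast_zero, Nat.cast_one, sub_zero] at h₀ h₁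
  have h₂ := abs_le.1 (abs_sub_round (u / 2))
  have k₁ := round_le ((u - 1) / 2) (round (u / 2))
  have k₂ := round_le ((u - 1) / 2) (round (u / 2) - 1)
  push_cast at k₁ k₂
  rcases le_abs.1 h₀ with h₀ | h₀
  · have : |(u - 1) / 2 - round (u / 2)| < 3 / 10 := by rw [abs_lt]; constructor <;> linarith
    linarith
  · have : |(u - 1) / 2 - (round (u / 2) - 1)| < 3 / 10 := by rw [abs_lt]; constructor <;> linarith
    linarith

/-- Finitely many colours, such that each colour class is a disjoint family of cells whose size is
controlled by a mesh depending on the value of `ℓ`. -/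
lemma exists_coloured_cells {m : ℕ} {ρ : ℕ → ℝ} (hρ : ∀ n, 0 < ρ n) {U : Set (Fin m → ℝ)}
    (hU : IsOpen U) {l : (Fin m → ℝ) → ℝ} (hl : ContinuousOn l U) :
    ∃ (t : Bool × (Fin m → Bool) → (Fin m → ℝ) → I)
      (p : Bool × (Fin m → Bool) → (Fin m → ℝ) → ℤ × (Fin m → ℤ)),
      (∀ c, ∀ x ∈ U, ContinuousAt (t c) x) ∧
      (∀ c, ∀ x ∈ U, (∀ᶠ y in 𝓝 x, t c y = 0) ∨ ∀ᶠ y in 𝓝 x, p c y = p c x) ∧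
      (∀ x ∈ U, ∃ c, ∀ᶠ y in 𝓝 x, t c y = 1) ∧
      (∀ c x, |l x - (p c x).1| ≤ 1) ∧
      ∀ c x y, p c x = p c y → dist x y ≤ 2 * ρ (p c x).1.toNat := by
  set n : Bool → (Fin m → ℝ) → ℤ := fun e x => tentCenter e (l x)
  have hlc : ∀ x ∈ U, ContinuousAt l x := fun x hx => hl.continuousAt (hU.mem_nhds hx)
  have hcoord : ∀ (k : ℤ) (j : Fin m), Continuous fun x : Fin m → ℝ => x j / ρ k.toNat := by
    fun_prop
  have hn : ∀ e, ∀ x ∈ U, (∀ᶠ y in 𝓝 x, tent e (l y) = 0) ∨ ∀ᶠ y in 𝓝 x, n e y = n e x :=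
    fun e x hx => (tent_eq_zero_or_tentCenter_eq e (l x)).imp
      (hlc x hx).eventually (hlc x hx).eventually
  refine ⟨fun c x => tent c.1 (l x) * ∏ j, tent (c.2 j) (x j / ρ (n c.1 x).toNat),
    fun c x => (n c.1 x, fun j => tentCenter (c.2 j) (x j / ρ (n c.1 x).toNat)), ?_, ?_, ?_,
    fun c x => abs_sub_tentCenter_le _ _, ?_⟩
  · intro c x hx
    rcases hn c.1 x hx with h | h
    · refine ContinuousAt.congr (f := fun _ => 0) continuousAt_const ?_
      filter_upwards [h] with y hy
      rw [hy, zero_mul]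
    · refine ContinuousAt.congr
        (f := fun y => tent c.1 (l y) * ∏ j, tent (c.2 j) (y j / ρ (n c.1 x).toNat)) ?_ ?_
      · exact ((continuous_tent _).continuousAt.comp (hlc x hx)).mul
          (continuous_finsetProd _ fun j _ =>
            (continuous_tent _).comp (hcoord _ j)).continuousAt
      · filter_upwards [h] with y hy
        rw [hy]
  · intro c x hx
    rcases hn c.1 x hx with h | h
    · left
      filter_upwards [h] with y hy
      rw [hy, zero_mul]
    by_cases hj : ∃ j, ∀ᶠ y in 𝓝 x, tent (c.2 j) (y j / ρ (n c.1 x).toNat) = 0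
    · obtain ⟨j, hj⟩ := hj
      left
      filter_upwards [h, hj] with y hy hj
      rw [hy, Finset.prod_eq_zero (Finset.mem_univ j) hj, mul_zero]
    · right
      have : ∀ᶠ y in 𝓝 x, ∀ j, tentCenter (c.2 j) (y j / ρ (n c.1 x).toNat) =
          tentCenter (c.2 j) (x j / ρ (n c.1 x).toNat) := by
        refine Filter.eventually_all.2 fun j => ?_
        rcases tent_eq_zero_or_tentCenter_eq (c.2 j) (x j / ρ (n c.1 x).toNat) with h' | h'
        · exact (hj ⟨j, (hcoord _ j).continuousAt.eventually h'⟩).elim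
        · exact (hcoord _ j).continuousAt.eventually h'
      filter_upwards [h, this] with y hy hj
      rw [Prod.mk.injEq]
      exact ⟨hy, funext fun j => by rw [hy, hj j]⟩
  · intro x hx
    obtain ⟨e, he⟩ := exists_tent_eq_one (l x)
    choose e' he' using fun j => exists_tent_eq_one (x j / ρ (n e x).toNat)
    refine ⟨(e, e'), ?_⟩
    have he₀ := (hlc x hx).eventually he
    have hne : ∀ᶠ y in 𝓝 x, n e y = n e x := by
      refine (hn e x hx).resolve_left fun h => ?_
      obtain ⟨y, h₁, h₀⟩ := (he₀.and h).exists
      exact one_ne_zero (h₁.symm.trans h₀)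
    have hall : ∀ᶠ y in 𝓝 x, ∀ j, tent (e' j) (y j / ρ (n e x).toNat) = 1 :=
      Filter.eventually_all.2 fun j => (hcoord _ j).continuousAt.eventually (he' j)
    filter_upwards [he₀, hne, hall] with y h₁ h₂ h₃
    simp only [h₁, h₂, h₃, Finset.prod_const_one, mul_one]
  · intro c x y h
    rw [Prod.mk.injEq] at h
    obtain ⟨h₁, h₂⟩ := h
    refine (dist_pi_le_iff (by have := hρ (n c.1 x).toNat; positivity)).2 fun j => ?_
    have hj := congrFun h₂ j
    simp only [← h₁] at hj
    have a₁ := abs_sub_tentCenter_le (c.2 j) (x j / ρ (n c.1 x).toNat)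
    have a₂ := abs_sub_tentCenter_le (c.2 j) (y j / ρ (n c.1 x).toNat)
    rw [← hj] at a₂
    have hpos := hρ (n c.1 x).toNat
    have : |x j / ρ (n c.1 x).toNat - y j / ρ (n c.1 x).toNat| ≤ 2 := by
      rw [abs_le] at *
      constructor <;> linarith
    rwa [← sub_div, abs_div, abs_of_pos hpos, div_le_iff₀ hpos] at this

/-- A function blowing up arbitrarily slowly at a closed set. -/
lemma exists_slow_depth {X : Type*} [MetricSpace X] {B : Set X} (hB : IsClosed B)
    (hne : B.Nonempty) {ρ : ℕ → ℝ} (hρ : ∀ n, 0 < ρ n) (hanti : Antitone ρ) :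
    ∃ l : X → ℝ, ContinuousOn l Bᶜ ∧ (∀ (n : ℕ), ∀ x ∉ B, n + 1 < l x → infDist x B < ρ n) ∧
      ∀ b ∈ B, ∀ a : ℝ, ∀ᶠ x in 𝓝 b, x ∉ B → a < l x := by
  set g : ℝ → ℝ := fun s => ⨅ n : ℕ, (n + |s| * ρ n)
  have hbdd : ∀ s, BddBelow (Set.range fun n : ℕ => (n + |s| * ρ n)) := fun s =>
    ⟨0, by rintro _ ⟨n, rfl⟩; have := hρ n; dsimp only; positivity⟩
  have hle : ∀ (s : ℝ) (n : ℕ), g s ≤ n + |s| * ρ n := fun s n => ciInf_le (hbdd s) n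
  have hg : Continuous g := by
    refine (LipschitzWith.of_le_add_mul (Real.toNNReal (ρ 0)) fun s s' => ?_).continuous
    rw [Real.coe_toNNReal _ (hρ 0).le, ← sub_le_iff_le_add]
    refine le_ciInf fun n => ?_
    rw [sub_le_iff_le_add]
    refine (hle s n).trans ?_
    have h₁ : |s| ≤ |s'| + dist s s' := by
      have := abs_sub_abs_le_abs_sub s s'
      rw [Real.dist_eq]; linarith
    have h₂ := hanti (Nat.zero_le n)
    have h₃ := hρ n
    have h₄ := dist_nonneg (x := s) (y := s')
    calc (n : ℝ) + |s| * ρ n ≤ n + (|s'| + dist s s') * ρ n := by gcongr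
      _ = n + |s'| * ρ n + ρ n * dist s s' := by ring
      _ ≤ _ := by gcongr
  have hpos : ∀ x ∉ B, 0 < infDist x B := fun x hx => (hB.notMem_iff_infDist_pos hne).1 hx
  refine ⟨fun x => g (infDist x B)⁻¹, ?_, ?_, ?_⟩
  · exact hg.comp_continuousOn
      ((continuous_infDist_pt B).continuousOn.inv₀ fun x hx => (hpos x hx).ne')
  · intro n x hx h
    have h₀ := hpos x hx
    by_contra! hc
    refine h.not_ge ((hle _ n).trans ?_)
    rw [abs_of_pos (inv_pos.2 h₀)]
    gcongr
    rw [inv_mul_le_iff₀ h₀, mul_one]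
    exact hc
  · intro b hb a
    obtain ⟨N, hN⟩ := exists_nat_gt a
    have h₀ : infDist b B < ρ N / (N + 1) := by
      rw [infDist_zero_of_mem hb]
      have := hρ N
      positivity
    filter_upwards [(continuous_infDist_pt B).continuousAt.eventually_lt_const h₀] with x hx hxB
    refine hN.trans_le (le_ciInf fun n => ?_)
    have h₁ := hpos x hxB
    rw [abs_of_pos (inv_pos.2 h₁)]
    have h₃ := hρ n
    rcases le_total N n with h | h
    · have : (N : ℝ) ≤ n := by exact_mod_cast h
      have : 0 ≤ (infDist x B)⁻¹ * ρ n := by positivity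
      linarith
    · rw [lt_div_iff₀ (by positivity)] at hx
      have : (N : ℝ) + 1 ≤ (infDist x B)⁻¹ * ρ n := by
        rw [inv_mul_eq_div, le_div_iff₀ h₁, mul_comm]
        exact hx.le.trans (hanti h)
      have := n.cast_nonneg (α := ℝ)
      linarith

lemma exists_antitone_le {u : ℕ → ℝ} (hu : ∀ n, 0 < u n) :
    ∃ v : ℕ → ℝ, Antitone v ∧ (∀ n, 0 < v n) ∧ ∀ n, v n ≤ u n := by
  set v : ℕ → ℝ := fun n => Nat.rec (u 0) (fun k r => min r (u (k + 1))) n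
  refine ⟨v, antitone_nat_of_succ_le fun n => min_le_left _ _, fun n => ?_, fun n => ?_⟩
  · induction n with
    | zero => exact hu 0
    | succ n ih => exact lt_min ih (hu _)
  · cases n with
    | zero => exact le_rfl
    | succ n => exact min_le_right _ _

variable {Y : Type*} [MetricSpace Y]

/-- `ball y r` contracts to a point inside `ball y s`. -/
def Contracts (y : Y) (r s : ℝ) : Prop :=
  ∃ z ∈ ball y s, ∃ h : Y → I → Y, ContinuousOn (Function.uncurry h) (ball y r ×ˢ Set.univ) ∧
    (∀ w, h w 0 = w) ∧ (∀ w, h w 1 = z) ∧ ∀ w ∈ ball y r, ∀ t, h w t ∈ ball y s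

lemma Contracts.mono {y : Y} {r r' s : ℝ} (h : Contracts y r s) (hr : r' ≤ r) :
    Contracts y r' s := by
  obtain ⟨z, hz, h, hc, h₀, h₁, hs⟩ := h
  exact ⟨z, hz, h, hc.mono (Set.prod_mono_left (ball_subset_ball hr)), h₀, h₁,
    fun w hw => hs w (ball_subset_ball hr hw)⟩

lemma exists_uniform_contracts
    (hY : ∀ (y : Y) (ε : ℝ), 0 < ε → ∃ δ > 0, δ ≤ ε ∧ ∃ h : Y → I → Y,
      ContinuousOn (Function.uncurry h) (ball y δ ×ˢ Set.univ) ∧ (∀ w, h w 0 = w) ∧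
      (∀ w ∈ ball y δ, h w 1 = y) ∧ ∀ w ∈ ball y δ, ∀ t, h w t ∈ ball y δ)
    {K : Set Y} (hK : IsCompact K) {ε : ℝ} (hε : 0 < ε) :
    ∃ r > 0, ∀ y ∈ K, Contracts y r ε := by
  choose δ hδ hδε h hc h₀ h₁ hs using fun y => hY y (ε / 2) (half_pos hε)
  obtain ⟨r, hr, H⟩ := lebesgue_number_lemma_of_metric (c := fun y => ball y (δ y)) hK
    (fun _ => isOpen_ball) fun y _ => Set.mem_iUnion.2 ⟨y, mem_ball_self (hδ y)⟩
  refine ⟨r, hr, fun y hy => ?_⟩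
  obtain ⟨z, hz⟩ := H y hy
  have hyz : dist y z < ε / 2 := (hz (mem_ball_self hr)).trans_le (hδε z)
  classical
  refine ⟨z, ?_, fun w t => if t = 1 then z else h z w t, ?_, ?_, ?_, ?_⟩
  · rw [mem_ball']; linarith
  · refine ((hc z).mono (Set.prod_mono_left hz)).congr ?_
    rintro ⟨w, t⟩ ⟨hw, -⟩
    by_cases ht : t = 1
    · subst ht
      exact (if_pos rfl).trans (h₁ z w (hz hw)).symm
    · exact if_neg ht
  · exact fun w => (if_neg zero_ne_one).trans (h₀ z w)
  · exact fun w => if_pos rfl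
  · intro w hw t
    dsimp only
    split_ifs with ht
    · rw [mem_ball']; linarith
    · have := mem_ball.1 (hs z w (hz hw) t)
      have h₂ := dist_triangle_right (h z w t) y z
      have := hδε z
      rw [mem_ball]
      linarith

lemma exists_scales
    (hY : ∀ (y : Y) (ε : ℝ), 0 < ε → ∃ δ > 0, δ ≤ ε ∧ ∃ h : Y → I → Y,
      ContinuousOn (Function.uncurry h) (ball y δ ×ˢ Set.univ) ∧ (∀ w, h w 0 = w) ∧
      (∀ w ∈ ball y δ, h w 1 = y) ∧ ∀ w ∈ ball y δ, ∀ t, h w t ∈ ball y δ)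
    {K : Set Y} (hK : IsCompact K) :
    ∃ G : ℕ → ℕ → ℝ, (∀ j, Antitone (G j)) ∧ Antitone G ∧ (∀ j n, 0 < G j n) ∧
      (∀ n : ℕ, G 0 n ≤ 1 / (n + 1)) ∧
      ∀ j n, ∀ y ∈ K, Contracts y (2 * G (j + 1) n) (G j (n + 2) / 2) := by
  have step : ∀ g : {g : ℕ → ℝ // Antitone g ∧ ∀ n, 0 < g n},
      ∃ g' : {g : ℕ → ℝ // Antitone g ∧ ∀ n, 0 < g n}, g'.1 ≤ g.1 ∧
        ∀ n, ∀ y ∈ K, Contracts y (2 * g'.1 n) (g.1 (n + 2) / 2) := by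
    rintro ⟨g, -, hg⟩
    choose r hr hc using fun n => exists_uniform_contracts hY hK (half_pos (hg (n + 2)))
    obtain ⟨v, hv, hv₀, hle⟩ := exists_antitone_le (u := fun n => min (g n) (r n / 2))
      fun n => lt_min (hg n) (half_pos (hr n))
    refine ⟨⟨v, hv, hv₀⟩, fun n => (hle n).trans (min_le_left _ _), fun n y hy =>
      (hc n y hy).mono ?_⟩
    have := (hle n).trans (min_le_right _ _)
    dsimp only
    linarith
  choose next hle hc using step
  set g₀ : {g : ℕ → ℝ // Antitone g ∧ ∀ n, 0 < g n} := ⟨fun n => 1 / ((n : ℝ) + 1),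
    fun a b h => one_div_le_one_div_of_le (by positivity)
      (by have : (a : ℝ) ≤ b := by exact_mod_cast h
          linarith), fun n => by positivity⟩
  set G : ℕ → {g : ℕ → ℝ // Antitone g ∧ ∀ n, 0 < g n} := fun j => next^[j] g₀
  have hG : ∀ j, G (j + 1) = next (G j) := fun j => Function.iterate_succ_apply' _ _ _
  refine ⟨fun j => (G j).1, fun j => (G j).2.1, antitone_nat_of_succ_le fun j => ?_,
    fun j => (G j).2.2, fun n => le_rfl, fun j => ?_⟩
  · rw [hG]; exact hle _
  · dsimp only; rw [hG]; exact hc _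

/-- Correcting a map along the cells of one colour by contractions. -/
lemma exists_correction {X L : Type*} [TopologicalSpace X] {W S : Set X} {t : X → I} {p : X → L}
    (hW : IsOpen W) (ht : ∀ x ∈ W, ContinuousAt t x)
    (hp : ∀ x ∈ W, (∀ᶠ y in 𝓝 x, t y = 0) ∨ ∀ᶠ y in 𝓝 x, p y = p x)
    {y : L → Y} {r s : L → ℝ} (hc : ∀ x ∈ W, Contracts (y (p x)) (r (p x)) (s (p x)))
    {F : X → Y} (hF : ∀ x ∈ S, ContinuousAt F x)
    (hFr : ∀ x ∈ S, F x ∈ ball (y (p x)) (r (p x))) :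
    ∃ F' : X → Y, ∀ x ∈ W, (x ∈ S ∨ ∀ᶠ y in 𝓝 x, t y = 1) →
      ContinuousAt F' x ∧ F' x ∈ ball (y (p x)) (s (p x)) := by
  rcases W.eq_empty_or_nonempty with rfl | ⟨w, -⟩
  · exact ⟨F, fun x hx => hx.elim⟩
  have : Nonempty Y := ⟨F w⟩
  have hc' : ∀ q ∈ p '' W, Contracts (y q) (r q) (s q) := by
    rintro _ ⟨x, hx, rfl⟩
    exact hc x hx
  choose! z hz h hcont h₀ h₁ hs using hc'
  refine ⟨fun x => h (p x) (F x) (t x), fun x hx hxS => ?_⟩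
  have hpx := Set.mem_image_of_mem p hx
  rcases em (x ∈ S) with hS | hS
  · refine ⟨?_, hs _ hpx _ (hFr x hS) _⟩
    rcases hp x hx with h' | h'
    · refine (hF x hS).congr ?_
      filter_upwards [h', hW.mem_nhds hx] with v hv hvW
      rw [hv, h₀ _ (Set.mem_image_of_mem p hvW)]
    · refine ContinuousAt.congr (f := fun v => h (p x) (F v) (t v)) ?_ ?_
      · have hnhds : ball (y (p x)) (r (p x)) ×ˢ Set.univ ∈ 𝓝 (F x, t x) :=
          prod_mem_nhds (isOpen_ball.mem_nhds (hFr x hS)) Filter.univ_mem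
        exact ((hcont _ hpx).continuousAt hnhds).comp (f := fun v => (F v, t v))
          ((hF x hS).prodMk (ht x hx))
      · filter_upwards [h'] with v hv
        rw [hv]
  · have h1 := hxS.resolve_left hS
    have hpc : ∀ᶠ v in 𝓝 x, p v = p x := by
      refine (hp x hx).resolve_left fun h0 => ?_
      obtain ⟨v, h₁, h₀⟩ := (h1.and h0).exists
      exact one_ne_zero (h₁.symm.trans h₀)
    constructor
    · refine ContinuousAt.congr (f := fun _ => z (p x)) continuousAt_const ?_
      filter_upwards [h1, hpc] with v hv hpv
      rw [hv, hpv, h₁ _ hpx]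
    · dsimp only
      rw [h1.self_of_nhds, h₁ _ hpx]
      exact hz _ hpx

/-- Extension into a neighbourhood of `B`, with a modulus of continuity at `B`. -/
lemma exists_extension_near {m : ℕ} {B : Set (Fin m → ℝ)} (hB : IsCompact B) (hne : B.Nonempty)
    (hY : ∀ (y : Y) (ε : ℝ), 0 < ε → ∃ δ > 0, δ ≤ ε ∧ ∃ h : Y → I → Y,
      ContinuousOn (Function.uncurry h) (ball y δ ×ˢ Set.univ) ∧ (∀ w, h w 0 = w) ∧
      (∀ w ∈ ball y δ, h w 1 = y) ∧ ∀ w ∈ ball y δ, ∀ t, h w t ∈ ball y δ)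
    {f : (Fin m → ℝ) → Y} (hf : ContinuousOn f B) :
    ∃ (l : (Fin m → ℝ) → ℝ) (F : (Fin m → ℝ) → Y), ContinuousOn l Bᶜ ∧
      (∀ b ∈ B, ∀ a : ℝ, ∀ᶠ x in 𝓝 b, x ∉ B → a < l x) ∧
      ∀ x ∉ B, 4 < l x → ContinuousAt F x ∧ ∀ b ∈ B, dist x b = infDist x B →
        ∀ n : ℕ, n ≤ l x + 1 → dist (F x) (f b) < 1 / (n + 1) := by
  obtain ⟨G, hGn, hGj, hG₀, hG₁, hGc⟩ := exists_scales hY (hB.image_of_continuousOn hf)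
  set κ := Fintype.card (Bool × (Fin m → Bool)) with hκ
  have hunif := Metric.uniformContinuousOn_iff.1 (hB.uniformContinuousOn_of_continuous hf)
  choose u hu hfu using fun k => hunif (G κ (k + 5) / 2) (half_pos (hG₀ κ _))
  obtain ⟨v, hv, hv₀, hvu⟩ := exists_antitone_le (u := fun k => u k / 4)
    fun k => div_pos (hu k) (by norm_num)
  obtain ⟨l, hl, hlv, hlB⟩ := exists_slow_depth hB.isClosed hne hv₀ hv
  set W : Set (Fin m → ℝ) := Bᶜ ∩ l ⁻¹' Set.Ioi 4
  have hW : IsOpen W := hl.isOpen_inter_preimage hB.isClosed.isOpen_compl isOpen_Ioi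
  obtain ⟨t, p, ht, hp, ht₁, hlp, hdist⟩ := exists_coloured_cells (ρ := fun n => v (n - 3))
    (fun n => hv₀ _) hW (hl.mono Set.inter_subset_left)
  choose near hnear hnear' using fun x : Fin m → ℝ => hB.exists_infDist_eq_dist hne x
  -- nearest points of points of the same cell have close images
  have hclose : ∀ c, ∀ x ∈ W, ∀ x' ∈ W, p c x = p c x' → ∀ b ∈ B, dist x b = infDist x B →
      dist (f b) (f (near x')) < G κ ((p c x).1.toNat + 2) / 2 := by
    intro c x hx x' hx' hpx b hb hxb
    have h₁ := abs_le.1 (hlp c x)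
    have h₁' := abs_le.1 (hlp c x')
    rw [← hpx] at h₁'
    have h₄ : (4 : ℝ) < l x := hx.2
    have hn : 3 < (p c x).1 + 1 := by
      have : (3 : ℝ) < ((p c x).1 + 1 : ℤ) := by push_cast; linarith
      exact_mod_cast this
    obtain ⟨k, hk⟩ : ∃ k : ℕ, (p c x).1 = k + 3 := ⟨((p c x).1 - 3).toNat, by omega⟩
    have hk' : (p c x).1.toNat = k + 3 := by omega
    have hkR : ((p c x).1 : ℝ) = k + 3 := by exact_mod_cast hk
    have d₁ := hlv k x hx.1 (by linarith)
    have d₂ := hlv k x' hx'.1 (by linarith)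
    have d₃ := hdist c x x' hpx
    simp only [hk', Nat.add_sub_cancel] at d₃ ⊢
    rw [← hxb] at d₁
    rw [hnear'] at d₂
    refine hfu k b hb (near x') (hnear x') ?_
    have := hvu k
    have e₁ := dist_triangle b x (near x')
    have e₂ := dist_triangle x x' (near x')
    rw [dist_comm b x] at e₁
    linarith
  have main : ∀ (C : Finset (Bool × (Fin m → Bool))) (j : ℕ), j + C.card = κ →
      ∃ F : (Fin m → ℝ) → Y, ∀ x ∈ W, (∃ c ∈ C, ∀ᶠ y in 𝓝 x, t c y = 1) →
        ContinuousAt F x ∧ ∀ b ∈ B, dist x b = infDist x B →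
          ∀ n : ℕ, n ≤ l x + 1 → dist (F x) (f b) < G j n := by
    intro C
    induction C using Finset.induction_on with
    | empty => exact fun j _ => ⟨f, by simp⟩
    | insert c C hcC ih =>
      intro j hj
      rw [Finset.card_insert_of_notMem hcC] at hj
      obtain ⟨F, hF⟩ := ih (j + 1) (by omega)
      have hjκ : G κ ≤ G (j + 1) := hGj (by omega)
      have hjκ' : G κ ≤ G j := hGj (by omega)
      have hsel : ∀ q ∈ p c '' W, ∃ x ∈ W, p c x = q := fun q hq => hq
      choose! ξ hξW hξ using hsel
      have hpW : ∀ x ∈ W, p c x ∈ p c '' W := fun x hx => Set.mem_image_of_mem _ hx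
      obtain ⟨F', hF'⟩ := exists_correction (W := W)
        (S := {x | x ∈ W ∧ ∃ c ∈ C, ∀ᶠ y in 𝓝 x, t c y = 1})
        (t := t c) (p := p c) (y := fun q => f (near (ξ q)))
        (r := fun q => 2 * G (j + 1) q.1.toNat) (s := fun q => G j (q.1.toNat + 2) / 2)
        (F := F) hW (ht c) (hp c) (fun x hx => hGc _ _ _ (Set.mem_image_of_mem _ (hnear _)))
        (fun x hx => (hF x hx.1 hx.2).1) (by
          rintro x ⟨hx, hxC⟩
          have h₁ := abs_le.1 (hlp c x)
          have h₄ : (4 : ℝ) < l x := hx.2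
          have hn : ((p c x).1.toNat : ℝ) ≤ l x + 1 := by
            have : ((p c x).1.toNat : ℤ) = (p c x).1 := by
              have : (0 : ℝ) < (p c x).1 := by linarith
              have : 0 < (p c x).1 := by exact_mod_cast this
              omega
            have : ((p c x).1.toNat : ℝ) = (p c x).1 := by exact_mod_cast this
            linarith
          have d₁ := (hF x hx hxC).2 (near x) (hnear x) (hnear' x).symm _ hn
          have d₂ := hclose c x hx _ (hξW _ (hpW x hx)) (hξ _ (hpW x hx)).symm _ (hnear x)
            (hnear' x).symm
          have d₃ := hjκ ((p c x).1.toNat + 2)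
          have d₄ := hGn (j + 1) (show (p c x).1.toNat ≤ (p c x).1.toNat + 2 by omega)
          have d₅ := dist_triangle (F x) (f (near x)) (f (near (ξ (p c x))))
          have d₆ := hG₀ (j + 1) (p c x).1.toNat
          rw [mem_ball]
          linarith)
      refine ⟨F', fun x hx hxC => ?_⟩
      have hxS : x ∈ {x | x ∈ W ∧ ∃ c ∈ C, ∀ᶠ y in 𝓝 x, t c y = 1} ∨ ∀ᶠ y in 𝓝 x, t c y = 1 := by
        obtain ⟨c', hc', h⟩ := hxC
        rcases Finset.mem_insert.1 hc' with rfl | hc'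
        · exact Or.inr h
        · exact Or.inl ⟨hx, c', hc', h⟩
      refine ⟨(hF' x hx hxS).1, fun b hb hxb n hn => ?_⟩
      have d₁ := mem_ball.1 (hF' x hx hxS).2
      have d₂ := hclose c x hx _ (hξW _ (hpW x hx)) (hξ _ (hpW x hx)).symm b hb hxb
      have d₃ := hjκ' ((p c x).1.toNat + 2)
      have d₄ : G j ((p c x).1.toNat + 2) ≤ G j n := by
        refine hGn j ?_
        have h₁ := abs_le.1 (hlp c x)
        have : (n : ℝ) ≤ ((p c x).1 + 2 : ℤ) := by push_cast; linarith
        have : (n : ℤ) ≤ (p c x).1 + 2 := by exact_mod_cast this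
        omega
      have d₅ := dist_triangle_right (F' x) (f b) (f (near (ξ (p c x))))
      linarith
  obtain ⟨F, hF⟩ := main Finset.univ 0 (by rw [zero_add, Finset.card_univ])
  refine ⟨l, F, hl, hlB, fun x hx hlx => ?_⟩
  obtain ⟨c, hc⟩ := ht₁ x ⟨hx, hlx⟩
  obtain ⟨h₁, h₂⟩ := hF x ⟨hx, hlx⟩ ⟨c, Finset.mem_univ c, hc⟩
  exact ⟨h₁, fun b hb hxb n hn => (h₂ b hb hxb n hn).trans_le (hG₁ n)⟩

/-- Maps from compact subsets of `ℝᵐ` to contractible, locally contractible metric spaces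
extend. -/
theorem exists_continuous_extension {m : ℕ} {B : Set (Fin m → ℝ)} (hB : IsCompact B)
    (hY : ∀ (y : Y) (ε : ℝ), 0 < ε → ∃ δ > 0, δ ≤ ε ∧ ∃ h : Y → I → Y,
      ContinuousOn (Function.uncurry h) (ball y δ ×ˢ Set.univ) ∧ (∀ w, h w 0 = w) ∧
      (∀ w ∈ ball y δ, h w 1 = y) ∧ ∀ w ∈ ball y δ, ∀ t, h w t ∈ ball y δ)
    {y₀ : Y} {H : Y → I → Y} (hH : Continuous (Function.uncurry H)) (hH₀ : ∀ y, H y 0 = y)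
    (hH₁ : ∀ y, H y 1 = y₀) {f : (Fin m → ℝ) → Y} (hf : ContinuousOn f B) :
    ∃ F : (Fin m → ℝ) → Y, Continuous F ∧ Set.EqOn F f B := by
  rcases B.eq_empty_or_nonempty with rfl | hne
  · exact ⟨fun _ => y₀, continuous_const, Set.eqOn_empty _ _⟩
  obtain ⟨l, F, hl, hlB, hF⟩ := exists_extension_near hB hne hY hf
  classical
  set θ : (Fin m → ℝ) → I := fun x => Set.projIcc 0 1 zero_le_one (6 - l x)
  refine ⟨fun x => if x ∈ B then f x else H (F x) (θ x), ?_, fun x hx => if_pos hx⟩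
  rw [continuous_iff_continuousAt]
  intro x
  by_cases hx : x ∈ B
  · rw [Metric.continuousAt_iff', if_pos hx]
    intro ε hε
    obtain ⟨δ, hδ, hfδ⟩ := Metric.continuousOn_iff.1 hf x hx (ε / 2) (half_pos hε)
    obtain ⟨N, hN⟩ := exists_nat_one_div_lt (half_pos hε)
    filter_upwards [hlB x hx (max 6 N), ball_mem_nhds x (half_pos hδ)] with y hyl hyx
    split_ifs with hy
    · exact (hfδ y hy (by rw [mem_ball] at hyx; linarith)).trans (by linarith)
    · obtain ⟨h₆, hlN⟩ := max_lt_iff.1 (hyl hy)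
      have hθ : θ y = 0 := Set.projIcc_of_le_left _ (by linarith)
      obtain ⟨b, hb, hyb⟩ := hB.exists_infDist_eq_dist hne y
      rw [hθ, hH₀]
      have d₁ := (hF y hy (by linarith)).2 b hb hyb.symm N (by linarith)
      have d₂ : dist y b ≤ dist y x := hyb ▸ infDist_le_dist_of_mem hx
      have d₃ := dist_triangle_left b x y
      rw [mem_ball] at hyx
      have d₄ := hfδ b hb (by linarith)
      have d₅ := dist_triangle (F y) (f b) (f x)
      linarith
  · have hxB : Bᶜ ∈ 𝓝 x := hB.isClosed.isOpen_compl.mem_nhds hx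
    have hlx := hl.continuousAt hxB
    rcases lt_or_ge 4 (l x) with h | h
    · refine ContinuousAt.congr (f := fun x => H (F x) (θ x)) ?_ ?_
      · exact (hH.continuousAt (x := (F x, θ x))).comp (f := fun v => (F v, θ v))
          ((hF x hx h).1.prodMk
            (continuous_projIcc.continuousAt.comp (continuousAt_const.sub hlx)))
      · filter_upwards [hxB] with y hy
        exact (if_neg hy).symm
    · refine ContinuousAt.congr (f := fun _ => y₀) continuousAt_const ?_
      filter_upwards [hxB, hlx.eventually_lt_const (show l x < 5 by linarith)] with y hy hly
      rw [if_neg hy, show θ y = 1 from Set.projIcc_of_right_le _ (by linarith), hH₁]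

end Extension

/-! ### The direct limit topology -/

namespace PersDiag

lemma DD_mono {n N : ℕ} (h : n ≤ N) : DD n ⊆ DD N := fun _ hμ =>
  ⟨hμ.1.trans h, hμ.2.trans fun _ hp => ⟨hp.1, hp.2.1, hp.2.2.trans (by exact_mod_cast h)⟩⟩

lemma exists_mem_DD (μ : PersDiag) : ∃ n, μ ∈ DD n := by
  obtain ⟨C, hC⟩ := (μ.finite_support.image Prod.snd).bddAbove
  obtain ⟨n, hn⟩ := exists_nat_ge C
  refine ⟨max n (Function.support μ.toFun).ncard, le_max_right _ _, fun p hp => ?_⟩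
  have h := μ.support_subset hp
  refine ⟨h.1, h.2.le, (hC (Set.mem_image_of_mem _ hp)).trans (hn.trans ?_)⟩
  exact_mod_cast le_max_left _ _

lemma continuous_DDtoDInf (n : ℕ) : Continuous (DDtoDInf n) :=
  continuous_iff_coinduced_le.2 (le_iSup (fun n => TopologicalSpace.coinduced (DDtoDInf n) _) n)

/-- The identity of the set of persistence diagrams, from the direct limit topology to the
bottleneck topology. -/
def ofDInf (μ : DInf) : PersDiag := μ

lemma continuous_ofDInf : Continuous ofDInf :=
  continuous_iSup_dom.2 fun _ => continuous_coinduced_dom.2 continuous_subtype_val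

instance : T2Space DInf :=
  T2Space.of_injective_continuous (f := ofDInf) (fun _ _ h => h) continuous_ofDInf

lemma isOpen_DInf_iff {U : Set DInf} : IsOpen U ↔ ∀ n, IsOpen (DDtoDInf n ⁻¹' U) := by
  rw [isOpen_iSup_iff]
  rfl

lemma exists_subset_DD_of_isCompact {K : Set DInf} (hK : IsCompact K) :
    ∃ n, ∀ μ ∈ K, ofDInf μ ∈ DD n := by
  by_contra! h
  choose x hxK hx using h
  have hopen : ∀ n, IsOpen {μ : DInf | ∀ k ≥ n, μ ≠ x k} := fun n => by
    refine isOpen_DInf_iff.2 fun j => ?_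
    rw [← isClosed_compl_iff]
    refine Set.Finite.isClosed (Set.Finite.of_finite_image
      (f := Subtype.val) (((Set.finite_Iio j).image x).subset ?_) Subtype.val_injective.injOn)
    rintro _ ⟨μ, hμ, rfl⟩
    simp only [Set.mem_compl_iff, Set.mem_preimage, Set.mem_ofPred_eq, not_forall, not_not] at hμ
    obtain ⟨k, -, hk⟩ := hμ
    refine ⟨k, lt_of_not_ge fun hjk => hx k (DD_mono hjk ?_), hk.symm⟩
    rw [← hk]
    exact μ.2
  obtain ⟨n, hn⟩ := hK.elim_directed_cover _ hopen
    (fun μ _ => by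
      obtain ⟨n, hn⟩ := exists_mem_DD μ
      refine Set.mem_iUnion.2 ⟨n, fun k hk h => hx k (DD_mono hk ?_)⟩
      rw [← h]
      exact hn)
    (directed_of_isDirected_le fun a b hab μ hμ k hk => hμ k (hab.trans hk))
  exact hn (hxK n) n le_rfl rfl

/-! ### Making a map injective -/

lemma continuous_superpose : Continuous fun z : PersDiag × PersDiag => z.1.superpose z.2 :=
  Metric.continuous_iff.2 fun _ ε hε => ⟨ε, hε, fun _ h =>
    dist_superpose_lt ((le_max_left _ _).trans_lt h) ((le_max_right _ _).trans_lt h)⟩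

/-- The diagram with a point `v i` for each `i`. -/
def ofFamily_s7 {m : ℕ} (v : Fin m → ℝ × ℝ) : PersDiag := ofMultiset (Finset.univ.val.map v)

section ofFamily_s7

variable {m : ℕ} {v : Fin m → ℝ × ℝ}

lemma isRep_ofFamily (hv : ∀ i, v i ∈ upperRegion) :
    (ofFamily_s7 v).IsRep (Finset.univ.val.map v) :=
  isRep_ofMultiset fun p hp => by
    obtain ⟨i, -, rfl⟩ := Multiset.mem_map.1 hp
    exact hv i

lemma mem_support_ofFamily {p : ℝ × ℝ} :
    p ∈ Function.support (ofFamily_s7 v).toFun ↔ p ∈ offDiag ∧ ∃ i, v i = p := by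
  simp only [ofFamily_s7, ofMultiset, Function.mem_support, ne_eq, ite_eq_right_iff, Classical.not_imp,
    Multiset.count_eq_zero, not_not, Multiset.mem_map, Finset.mem_val, Finset.mem_univ, true_and]

lemma dist_ofFamily_lt {w : Fin m → ℝ × ℝ} (hv : ∀ i, v i ∈ upperRegion)
    (hw : ∀ i, w i ∈ upperRegion) {r : ℝ} (h : dist v w < r) :
    dist (ofFamily_s7 v) (ofFamily_s7 w) < r := by
  refine (dist_lt_iff (dist_nonneg.trans_lt h)).2
    ⟨Finset.univ.val.map fun i => (v i, w i), ?_, ?_, fun z hz => ?_⟩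
  · simpa [Multiset.map_map, Function.comp_def] using isRep_ofFamily hv
  · simpa [Multiset.map_map, Function.comp_def] using isRep_ofFamily hw
  · obtain ⟨i, -, rfl⟩ := Multiset.mem_map.1 hz
    exact (dist_le_pi_dist v w i).trans_lt h

lemma continuous_ofFamily {X : Type*} [TopologicalSpace X] {v : X → Fin m → ℝ × ℝ}
    (hv : Continuous v) (hu : ∀ x i, v x i ∈ upperRegion) : Continuous fun x => ofFamily_s7 (v x) := by
  refine continuous_iff_continuousAt.2 fun x => Metric.tendsto_nhds.2 fun ε hε => ?_
  filter_upwards [hv.continuousAt (Metric.ball_mem_nhds _ hε)] with y hy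
  exact dist_ofFamily_lt (hu y) (hu x) hy

end ofFamily_s7

lemma eq_of_superpose_eq {n : ℕ} {μ μ' ν ν' : PersDiag} (hμ : μ ∈ DD n) (hμ' : μ' ∈ DD n)
    (hν : Disjoint (Function.support ν.toFun) (triangle n))
    (hν' : Disjoint (Function.support ν'.toFun) (triangle n))
    (h : μ.superpose ν = μ'.superpose ν') : μ = μ' ∧ ν = ν' := by
  have hp : ∀ p, μ.toFun p + ν.toFun p = μ'.toFun p + ν'.toFun p := fun p =>
    congrFun (congrArg toFun h) p
  have hzero : ∀ {μ : PersDiag} {p}, p ∉ Function.support μ.toFun → μ.toFun p = 0 :=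
    Function.notMem_support.1
  have key : ∀ p, μ.toFun p = μ'.toFun p ∧ ν.toFun p = ν'.toFun p := fun p => by
    have := hp p
    by_cases hpn : p ∈ triangle n
    · have h₁ := hzero (hν.notMem_of_mem_right hpn)
      have h₂ := hzero (hν'.notMem_of_mem_right hpn)
      omega
    · have h₁ := hzero fun h => hpn (hμ.2 h)
      have h₂ := hzero fun h => hpn (hμ'.2 h)
      omega
  exact ⟨ext fun p _ => (key p).1, ext fun p _ => (key p).2⟩

lemma exists_continuous_zero_iff {X : Type*} [MetricSpace X] {B : Set X} (hB : IsClosed B) :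
    ∃ s : X → ℝ, Continuous s ∧ (∀ x, 0 ≤ s x) ∧ (∀ x, s x ≤ 1) ∧ ∀ x, s x = 0 ↔ x ∈ B := by
  rcases B.eq_empty_or_nonempty with rfl | hne
  · exact ⟨fun _ => 1, continuous_const, by simp, by simp, by simp⟩
  · refine ⟨fun x => min (Metric.infDist x B) 1,
      (Metric.continuous_infDist_pt B).min continuous_const,
      fun x => le_min Metric.infDist_nonneg zero_le_one, fun x => min_le_right _ _, fun x => ?_⟩
    rw [hB.mem_iff_infDist_zero hne]
    dsimp only
    refine ⟨fun h => ?_, fun h => by rw [h, min_eq_left zero_le_one]⟩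
    rcases min_choice (Metric.infDist x B) 1 with h' | h'
    · rwa [h'] at h
    · rw [h'] at h
      exact (one_ne_zero h).elim

lemma exists_injective_perturbation {m n : ℕ} {B : Set (Fin m → ℝ)} (hB : IsClosed B)
    {F : (Fin m → ℝ) → DD n} (hF : Continuous F) (hinj : Set.InjOn F B) :
    ∃ (N : ℕ) (g : (Fin m → ℝ) → DD N), Continuous g ∧ Function.Injective g ∧
      ∀ x ∈ B, (g x).1 = (F x).1 := by
  obtain ⟨s, hs, hs₀, hs₁, hsB⟩ := exists_continuous_zero_iff hB
  set a : (Fin m → ℝ) → Fin m → ℝ := fun x i => n + 1 + i + Real.sigmoid (x i) with ha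
  have ha₀ : ∀ x i, n + 1 + i < a x i := fun x i => lt_add_of_pos_right _ (Real.sigmoid_pos _)
  have ha₁ : ∀ x i, a x i < n + 1 + i + 1 := fun x i => add_lt_add_right (Real.sigmoid_lt_one _) _
  set v : (Fin m → ℝ) → Fin m → ℝ × ℝ := fun x i => (a x i, a x i + s x) with hv
  have hvu : ∀ x i, v x i ∈ upperRegion := fun x i =>
    ⟨le_trans (by positivity) (ha₀ x i).le, le_add_of_nonneg_right (hs₀ x)⟩
  have hvo : ∀ {x} i, x ∉ B → v x i ∈ offDiag := fun {x} i hx =>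
    ⟨(hvu x i).1, lt_add_of_pos_right _ ((hs₀ x).lt_of_ne' (mt (hsB x).1 hx))⟩
  have hvB : ∀ {x} i, x ∈ B → v x i ∈ diagSet := fun {x} i hx =>
    ⟨(hvu x i).1, by simp [hv, (hsB x).2 hx]⟩
  have hdisj : ∀ x, Disjoint (Function.support (ofFamily_s7 (v x)).toFun) (triangle n) := fun x => by
    refine Set.disjoint_left.2 fun p hp hpn => ?_
    obtain ⟨-, i, rfl⟩ := mem_support_ofFamily.1 hp
    have h₁ := ha₀ x i
    have h₂ : a x i + s x ≤ n := hpn.2.2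
    have h₃ : (0 : ℝ) ≤ i := by positivity
    linarith [hs₀ x]
  have hsupp : ∀ x, Function.support ((F x).1.superpose (ofFamily_s7 (v x))).toFun ⊆
      Function.support (F x).1.toFun ∪ Set.range (v x) := fun x =>
    (Function.support_add _ _).trans
      (Set.union_subset_union_right _ fun p hp => (mem_support_ofFamily.1 hp).2)
  have hmem : ∀ x, (F x).1.superpose (ofFamily_s7 (v x)) ∈ DD (n + m + 2) := fun x => by
    constructor
    · refine (Set.ncard_le_ncard (hsupp x)
        ((F x).1.finite_support.union (Set.finite_range _))).trans
          ((Set.ncard_union_le _ _).trans ?_)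
      have h₁ := (F x).2.1
      have h₂ : (Set.range (v x)).ncard ≤ m := by
        rw [← Set.image_univ]
        exact (Set.ncard_image_le Set.finite_univ).trans (by simp)
      omega
    · refine (hsupp x).trans (Set.union_subset
        ((F x).2.2.trans fun p hp => ⟨hp.1, hp.2.1, hp.2.2.trans ?_⟩) ?_)
      · push_cast
        linarith [m.cast_nonneg (α := ℝ)]
      · rintro _ ⟨i, rfl⟩
        refine ⟨(hvu x i).1, (hvu x i).2, ?_⟩
        have h₁ : (i : ℝ) + 1 ≤ m := by exact_mod_cast i.2
        have h₂ := ha₁ x i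
        change a x i + s x ≤ _
        push_cast
        linarith [hs₁ x]
  refine ⟨n + m + 2, fun x => ⟨_, hmem x⟩, ?_, fun x y hxy => ?_, fun x hx => ?_⟩
  · have hac : Continuous a := by
      refine continuous_pi fun i => continuous_const.add ?_
      exact continuous_sigmoid.comp (continuous_apply i)
    have hvc : Continuous v := continuous_pi fun i =>
      ((continuous_apply i).comp hac).prodMk (((continuous_apply i).comp hac).add hs)
    exact (continuous_superpose.comp
      ((continuous_subtype_val.comp hF).prodMk (continuous_ofFamily hvc hvu))).subtype_mk _
  · obtain ⟨h₁, h₂⟩ := eq_of_superpose_eq (F x).2 (F y).2 (hdisj x) (hdisj y)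
      (congrArg Subtype.val hxy)
    have hB' : ∀ {x y}, ofFamily_s7 (v x) = ofFamily_s7 (v y) → x ∉ B → ∀ i, y ∉ B ∧ x i = y i := by
      intro x y h hx i
      have hmem : v x i ∈ Function.support (ofFamily_s7 (v y)).toFun :=
        h ▸ mem_support_ofFamily.2 ⟨hvo i hx, i, rfl⟩
      obtain ⟨ho, j, hj⟩ := mem_support_ofFamily.1 hmem
      refine ⟨fun hy => notMem_offDiag_of_mem_diagSet (hvB j hy) (hj ▸ ho), ?_⟩
      have haj : a y j = a x i := congrArg Prod.fst hj
      have hij : j = i := by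
        have e₁ := ha₀ x i
        have e₂ := ha₁ x i
        have e₃ := ha₀ y j
        have e₄ := ha₁ y j
        have f₁ : (i : ℝ) < j + 1 := by linarith
        have f₂ : (j : ℝ) < i + 1 := by linarith
        norm_cast at f₁ f₂
        exact Fin.ext (by omega)
      subst hij
      exact (Real.sigmoid_injective (add_left_cancel haj)).symm
    by_cases hx : x ∈ B
    · by_cases hy : y ∈ B
      · exact hinj hx hy (Subtype.ext h₁)
      · exact funext fun i => (hB' h₂.symm hy i).2.symm
    · exact funext fun i => (hB' h₂ hx i).2
  · have h := (F x).1.isRep_toMultiset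
    refine ((h.superpose (isRep_ofFamily (hvu x))).unique (h.add_diag fun p hp => ?_))
    obtain ⟨i, -, rfl⟩ := Multiset.mem_map.1 hp
    exact hvB i hx

end PersDiag

/-- for a compact set `A ⊆ ℝᵐ`, a closed subset `B ⊆ A`, and a topological
embedding `f : B → 𝒟∞`, there is a topological embedding `f̄ : A → 𝒟∞` extending `f`. -/
theorem embedding_extends (m : ℕ) (A B : Set (EuclideanSpace ℝ (Fin m)))
    (hA : IsCompact A) (hBA : B ⊆ A) (hB : IsClosed B)
    (f : B → DInf) (hf : Topology.IsEmbedding f) :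
    ∃ fbar : A → DInf, Topology.IsEmbedding fbar ∧
      ∀ b : B, fbar ⟨(b : EuclideanSpace ℝ (Fin m)), hBA b.2⟩ = f b := by
  obtain ⟨n, hn⟩ := PersDiag.exists_subset_DD_of_isCompact (K := Set.range f) <| by
    have := isCompact_iff_compactSpace.1 (hA.of_isClosed_subset hB hBA)
    exact isCompact_range hf.continuous
  have hfn : ∀ b, PersDiag.ofDInf (f b) ∈ DD n := fun b => hn _ (Set.mem_range_self b)
  set φ : EuclideanSpace ℝ (Fin m) ≃ₜ (Fin m → ℝ) :=
    (EuclideanSpace.equiv (Fin m) ℝ).toHomeomorph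
  have hB' : IsCompact (φ.symm ⁻¹' B) :=
    φ.symm.isCompact_preimage.2 (hA.of_isClosed_subset hB hBA)
  classical
  set f' : (Fin m → ℝ) → DD n := fun x =>
    if hx : φ.symm x ∈ B then ⟨_, hfn ⟨φ.symm x, hx⟩⟩ else ⟨_, PersDiag.empty_mem_DD n⟩ with hf'
  have hf'B : ∀ x (hx : φ.symm x ∈ B), f' x = ⟨_, hfn ⟨φ.symm x, hx⟩⟩ := fun x hx => dif_pos hx
  have hf'c : ContinuousOn f' (φ.symm ⁻¹' B) := by
    rw [continuousOn_iff_continuous_domRestrict]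
    have : Continuous fun x : φ.symm ⁻¹' B =>
        (⟨_, hfn ⟨φ.symm x, x.2⟩⟩ : DD n) :=
      (PersDiag.continuous_ofDInf.comp (hf.continuous.comp
        ((φ.symm.continuous.comp continuous_subtype_val).subtype_mk _))).subtype_mk _
    exact this.congr fun x => (hf'B x x.2).symm
  obtain ⟨μ₀, H, hH, hH₀, hH₁⟩ := PersDiag.exists_contraction_DD n
  obtain ⟨F, hF, hFf⟩ := exists_continuous_extension hB'
    (fun μ ε hε => PersDiag.exists_local_contraction_DD μ hε) hH hH₀ hH₁ hf'c
  have hinj : Set.InjOn F (φ.symm ⁻¹' B) := fun x hx y hy hxy => by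
    rw [hFf hx, hFf hy, hf'B x hx, hf'B y hy] at hxy
    have := hf.injective (congrArg Subtype.val hxy)
    exact φ.symm.injective (congrArg Subtype.val this)
  obtain ⟨N, g, hg, hginj, hgB⟩ :=
    PersDiag.exists_injective_perturbation hB'.isClosed hF hinj
  have := isCompact_iff_compactSpace.1 hA
  refine ⟨fun x => DDtoDInf N (g (φ x)), ?_, fun b => ?_⟩
  · refine (Continuous.isClosedEmbedding ((PersDiag.continuous_DDtoDInf N).comp
      (hg.comp (φ.continuous.comp continuous_subtype_val))) ?_).isEmbedding
    exact fun x y h => Subtype.ext (φ.injective (hginj (Subtype.ext h)))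
  · have hb : φ.symm (φ b) ∈ B := by rw [φ.symm_apply_apply]; exact b.2
    refine (hgB (φ b) hb).trans ?_
    rw [hFf hb, hf'B _ hb]
    exact congrArg f (Subtype.ext (φ.symm_apply_apply _))
end
end
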